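/- Let l = l(n) be a sequence of positive integers such that l(n) → ∞ and ln n / ln l(n) → ∞ as n → ∞. Then D^tree(n, l(n)) · ln l(n) / (l(n) · ln n) → 1/2 as n → ∞. Moreover, the lower bound is achieved by uncolored trees: for every ε > 0 and all sufficiently large n there is an (uncolored) tree T with at most n vertices and maximum degree at most l(n) such that D(T) ≥ (1/2 − ε) · l(n) · ln n / ln l(n). -/

import Mathlib

namespace FODef

/-- A graph colored with `K` unary predicates. -/
structure CGraph (K : ℕ) (V : Type) where
  graph : SimpleGraph V
  color : Fin K → V → Prop

/-- First-order formulas in the language of graphs with `K` unary color predicates,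
with free variables among `x_0, …, x_{n-1}`. -/
inductive CForm (K : ℕ) : ℕ → Type
  | adj {n : ℕ} (i j : Fin n) : CForm K n
  | eq {n : ℕ} (i j : Fin n) : CForm K n
  | col {n : ℕ} (c : Fin K) (i : Fin n) : CForm K n
  | neg {n : ℕ} : CForm K n → CForm K n
  | conj {n : ℕ} : CForm K n → CForm K n → CForm K n
  | disj {n : ℕ} : CForm K n → CForm K n → CForm K n
  | ex {n : ℕ} : CForm K (n + 1) → CForm K n
  | fa {n : ℕ} : CForm K (n + 1) → CForm K n

/-- Realization of a formula in a colored graph, under a valuation of the free variables. -/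
def CForm.Realize {K : ℕ} {V : Type} (C : CGraph K V) :
    ∀ {n : ℕ}, CForm K n → (Fin n → V) → Prop
  | _, .adj i j, f => C.graph.Adj (f i) (f j)
  | _, .eq i j, f => f i = f j
  | _, .col c i, f => C.color c (f i)
  | _, .neg φ, f => ¬ CForm.Realize C φ f
  | _, .conj φ ψ, f => CForm.Realize C φ f ∧ CForm.Realize C ψ f
  | _, .disj φ ψ, f => CForm.Realize C φ f ∨ CForm.Realize C ψ f
  | _, .ex φ, f => ∃ v : V, CForm.Realize C φ (Fin.snoc f v)
  | _, .fa φ, f => ∀ v : V, CForm.Realize C φ (Fin.snoc f v)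

/-- Quantifier depth: the maximum number of nested quantifiers. -/
def CForm.depth {K : ℕ} : ∀ {n : ℕ}, CForm K n → ℕ
  | _, .adj _ _ => 0
  | _, .eq _ _ => 0
  | _, .col _ _ => 0
  | _, .neg φ => φ.depth
  | _, .conj φ ψ => max φ.depth ψ.depth
  | _, .disj φ ψ => max φ.depth ψ.depth
  | _, .ex φ => φ.depth + 1
  | _, .fa φ => φ.depth + 1

/-- Isomorphism of colored graphs: a graph isomorphism preserving all colors. -/
def CIso {K : ℕ} {V W : Type} (C : CGraph K V) (C' : CGraph K W) : Prop :=
  ∃ e : V ≃ W, (∀ v w : V, C.graph.Adj v w ↔ C'.graph.Adj (e v) (e w)) ∧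
    ∀ (c : Fin K) (v : V), C.color c v ↔ C'.color c (e v)

/-- A sentence (formula with no free variables) holds in a colored graph. -/
def CSat {K : ℕ} {V : Type} (C : CGraph K V) (φ : CForm K 0) : Prop :=
  φ.Realize C ![]

/-- A sentence defines a colored graph `C` if `C` satisfies it and every finite colored
graph (in the same language) satisfying it is isomorphic to `C`. -/
def CDefines {K : ℕ} {V : Type} (C : CGraph K V) (φ : CForm K 0) : Prop :=
  CSat C φ ∧ ∀ (m : ℕ) (C' : CGraph K (Fin m)), CSat C' φ → CIso C C'

/-- Minimum quantifier depth of a first-order sentence defining a colored graph. -/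
noncomputable def Dcol {K : ℕ} {V : Type} (C : CGraph K V) : ℕ :=
  sInf {d | ∃ φ : CForm K 0, φ.depth = d ∧ CDefines C φ}

/-- A colored tree: the underlying graph is connected and acyclic. -/
def IsColTree {K : ℕ} {V : Type} (C : CGraph K V) : Prop :=
  C.graph.Connected ∧ C.graph.IsAcyclic

/-- Degree of a vertex. -/
noncomputable def deg {V : Type} (G : SimpleGraph V) (v : V) : ℕ :=
  Nat.card {w // G.Adj v w}

/-- `Dtree n l`: the maximum of `Dcol T` over all colored trees `T` with at most `n`
vertices and maximum degree at most `l` (with any finite number of colors). -/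
noncomputable def Dtree (n l : ℕ) : ℕ :=
  sSup {d | ∃ (K m : ℕ) (C : CGraph K (Fin m)), IsColTree C ∧ m ≤ n ∧
    (∀ v, deg C.graph v ≤ l) ∧ d = Dcol C}

/-- An uncolored graph, viewed as a colored graph with no colors.  A sentence of the
pure graph language defines it iff it `CDefines` it, and `CIso` for such graphs is plain
graph isomorphism, so `Dcol (plain G)` is the minimum quantifier depth `D(G)` of a
first-order sentence defining the (uncolored) graph `G`. -/
def plain {V : Type} (G : SimpleGraph V) : CGraph 0 V :=
  ⟨G, fun c _ => c.elim0⟩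

end FODef

namespace FODef

variable {K : ℕ} {V W : Type}

/-- A set of pairs of vertices is a partial isomorphism of colored graphs. -/
def PartialIso (C : CGraph K V) (C' : CGraph K W) (P : Set (V × W)) : Prop :=
  ∀ p ∈ P, ∀ q ∈ P, (p.1 = q.1 ↔ p.2 = q.2) ∧
    (C.graph.Adj p.1 q.1 ↔ C'.graph.Adj p.2 q.2) ∧ ∀ c, (C.color c p.1 ↔ C'.color c p.2)

/-- Duplicator wins the `k`-round Ehrenfeucht game from position `P`, where a final position
is won if it satisfies `B`. -/
def BackForth (B : Set (V × W) → Prop) : ℕ → Set (V × W) → Prop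
  | 0, P => B P
  | k + 1, P => (∀ v, ∃ w, BackForth B k (insert (v, w) P)) ∧
      ∀ w, ∃ v, BackForth B k (insert (v, w) P)

lemma PartialIso.mono {C : CGraph K V} {C' : CGraph K W} : Antitone (PartialIso C C') :=
  fun _ _ h hP p hp q hq => hP p (h hp) q (h hq)

lemma BackForth.mono {B : Set (V × W) → Prop} (hB : Antitone B) (k : ℕ) :
    Antitone (BackForth B k) := by
  induction k with
  | zero => exact hB
  | succ k ih =>
    intro P Q h hQ
    refine ⟨fun v => ?_, fun w => ?_⟩
    · obtain ⟨w, hw⟩ := hQ.1 v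
      exact ⟨w, ih (Set.insert_subset_insert h) hw⟩
    · obtain ⟨v, hv⟩ := hQ.2 w
      exact ⟨v, ih (Set.insert_subset_insert h) hv⟩

lemma BackForth.imp {B B' : Set (V × W) → Prop} (h : ∀ P, B P → B' P) (k : ℕ) :
    ∀ P, BackForth B k P → BackForth B' k P := by
  induction k with
  | zero => exact h
  | succ k ih =>
    intro P hP
    refine ⟨fun v => ?_, fun w => ?_⟩
    · obtain ⟨w, hw⟩ := hP.1 v
      exact ⟨w, ih _ hw⟩
    · obtain ⟨v, hv⟩ := hP.2 w
      exact ⟨v, ih _ hv⟩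

lemma BackForth.of_succ [Nonempty V] {B : Set (V × W) → Prop} (hB : Antitone B) {k : ℕ}
    {P : Set (V × W)} (h : BackForth B (k + 1) P) : BackForth B k P := by
  obtain ⟨w, hw⟩ := h.1 (Classical.arbitrary V)
  exact BackForth.mono hB k (Set.subset_insert _ _) hw

lemma BackForth.of_le [Nonempty V] {B : Set (V × W) → Prop} (hB : Antitone B) {j k : ℕ}
    (hjk : j ≤ k) {P : Set (V × W)} (h : BackForth B k P) : BackForth B j P := by
  induction hjk with
  | refl => exact h
  | step _ ih => exact ih (h.of_succ hB)

lemma BackForth.base [Nonempty V] {B : Set (V × W) → Prop} (hB : Antitone B) {k : ℕ}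
    {P : Set (V × W)} (h : BackForth B k P) : B P :=
  h.of_le hB (Nat.zero_le k)

/-- Playing `a` rounds and then `b` rounds. -/
lemma BackForth.of_add {B : Set (V × W) → Prop} {a b : ℕ} {P : Set (V × W)}
    (h : BackForth B (a + b) P) : BackForth (BackForth B b) a P := by
  induction a generalizing P with
  | zero =>
    rw [Nat.zero_add] at h
    exact h
  | succ a ih =>
    rw [Nat.succ_add] at h
    refine ⟨fun v => ?_, fun w => ?_⟩
    · obtain ⟨w, hw⟩ := h.1 v
      exact ⟨w, ih hw⟩
    · obtain ⟨v, hv⟩ := h.2 w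
      exact ⟨v, ih hv⟩

lemma BackForth.swap {B : Set (V × W) → Prop} {B' : Set (W × V) → Prop}
    (hBB : ∀ P, B P → B' (Prod.swap '' P)) (k : ℕ) :
    ∀ P, BackForth B k P → BackForth B' k (Prod.swap '' P) := by
  induction k with
  | zero => exact hBB
  | succ k ih =>
    intro P hP
    refine ⟨fun w => ?_, fun v => ?_⟩
    · obtain ⟨v, hv⟩ := hP.2 w
      exact ⟨v, by simpa [Set.image_insert_eq] using ih _ hv⟩
    · obtain ⟨w, hw⟩ := hP.1 v
      exact ⟨w, by simpa [Set.image_insert_eq] using ih _ hw⟩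

lemma range_snoc_pair {n : ℕ} (f : Fin n → V) (g : Fin n → W) (v : V) (w : W) :
    Set.range (fun i : Fin (n + 1) =>
      ((Fin.snoc f v : Fin (n + 1) → V) i, (Fin.snoc g w : Fin (n + 1) → W) i)) =
    insert (v, w) (Set.range fun i => (f i, g i)) := by
  ext p
  simp only [Set.mem_range, Set.mem_insert_iff]
  constructor
  · rintro ⟨i, rfl⟩
    induction i using Fin.lastCases with
    | last => left; simp
    | cast i => right; exact ⟨i, by simp⟩
  · rintro (rfl | ⟨i, rfl⟩)
    · exact ⟨Fin.last n, by simp⟩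
    · exact ⟨i.castSucc, by simp⟩

/-- Positions from which Duplicator survives `k` rounds satisfy the same formulas of quantifier
depth at most `k`. -/
theorem BackForth.realize_iff [Nonempty V] {C : CGraph K V} {C' : CGraph K W} {n : ℕ}
    (φ : CForm K n) : ∀ (k : ℕ) (f : Fin n → V) (g : Fin n → W), φ.depth ≤ k →
      BackForth (PartialIso C C') k (Set.range fun i => (f i, g i)) →
      (φ.Realize C f ↔ φ.Realize C' g) := by
  induction φ with
  | adj i j =>
    intro k f g _ h
    exact (h.base PartialIso.mono _ ⟨i, rfl⟩ _ ⟨j, rfl⟩).2.1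
  | eq i j =>
    intro k f g _ h
    exact (h.base PartialIso.mono _ ⟨i, rfl⟩ _ ⟨j, rfl⟩).1
  | col c i =>
    intro k f g _ h
    exact (h.base PartialIso.mono _ ⟨i, rfl⟩ _ ⟨i, rfl⟩).2.2 c
  | neg φ ih =>
    intro k f g hk h
    exact not_congr (ih k f g hk h)
  | conj φ ψ ih₁ ih₂ =>
    intro k f g hk h
    exact and_congr (ih₁ k f g (le_trans (le_max_left _ _) hk) h)
      (ih₂ k f g (le_trans (le_max_right _ _) hk) h)
  | disj φ ψ ih₁ ih₂ =>
    intro k f g hk h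
    exact or_congr (ih₁ k f g (le_trans (le_max_left _ _) hk) h)
      (ih₂ k f g (le_trans (le_max_right _ _) hk) h)
  | ex φ ih =>
    intro k f g hk h
    obtain _ | k := k
    · exact absurd hk (by simp [CForm.depth])
    have hk' : φ.depth ≤ k := by simpa [CForm.depth] using hk
    constructor
    · rintro ⟨v, hv⟩
      obtain ⟨w, hw⟩ := h.1 v
      exact ⟨w, (ih k _ _ hk' (by rwa [range_snoc_pair])).1 hv⟩
    · rintro ⟨w, hw⟩
      obtain ⟨v, hv⟩ := h.2 w
      exact ⟨v, (ih k _ _ hk' (by rwa [range_snoc_pair])).2 hw⟩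
  | fa φ ih =>
    intro k f g hk h
    obtain _ | k := k
    · exact absurd hk (by simp [CForm.depth])
    have hk' : φ.depth ≤ k := by simpa [CForm.depth] using hk
    constructor
    · intro hf w
      obtain ⟨v, hv⟩ := h.2 w
      exact (ih k _ _ hk' (by rwa [range_snoc_pair])).1 (hf v)
    · intro hg v
      obtain ⟨w, hw⟩ := h.1 v
      exact (ih k _ _ hk' (by rwa [range_snoc_pair])).2 (hg w)

lemma BackForth.csat_iff [Nonempty V] {C : CGraph K V} {C' : CGraph K W} {k : ℕ}
    (h : BackForth (PartialIso C C') k ∅) {φ : CForm K 0} (hφ : φ.depth ≤ k) :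
    CSat C φ ↔ CSat C' φ :=
  BackForth.realize_iff φ k _ _ hφ (h.mono PartialIso.mono k (by rintro _ ⟨i, -⟩; exact i.elim0))

lemma CIso.symm {C : CGraph K V} {C' : CGraph K W} (h : CIso C C') : CIso C' C := by
  obtain ⟨e, h₁, h₂⟩ := h
  exact ⟨e.symm, fun v w => by simp [h₁], fun c v => by simp [h₂]⟩

lemma CIso.refl (C : CGraph K V) : CIso C C := ⟨Equiv.refl V, by simp, by simp⟩

lemma CIso.trans {U : Type} {C : CGraph K V} {C' : CGraph K W} {C'' : CGraph K U}
    (h : CIso C C') (h' : CIso C' C'') : CIso C C'' := by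
  obtain ⟨e, h₁, h₂⟩ := h
  obtain ⟨e', h₁', h₂'⟩ := h'
  exact ⟨e.trans e', fun v w => by simp [h₁, h₁'], fun c v => by simp [h₂, h₂']⟩

/-- Isomorphic colored graphs cannot be distinguished. -/
lemma CIso.backForth {C : CGraph K V} {C' : CGraph K W} (h : CIso C C') (k : ℕ) :
    BackForth (PartialIso C C') k ∅ := by
  obtain ⟨e, h₁, h₂⟩ := h
  suffices BackForth (PartialIso C C') k {p | p.2 = e p.1} from
    this.mono PartialIso.mono k (Set.empty_subset _)
  induction k with
  | zero =>
    rintro ⟨a, a'⟩ ha ⟨b, b'⟩ hb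
    obtain rfl : a' = e a := ha
    obtain rfl : b' = e b := hb
    exact ⟨by simp, h₁ a b, fun c => h₂ c a⟩
  | succ k ih =>
    refine ⟨fun v => ⟨e v, ?_⟩, fun w => ⟨e.symm w, ?_⟩⟩
    · rwa [Set.insert_eq_of_mem (by simp)]
    · rwa [Set.insert_eq_of_mem (by simp)]

lemma CIso.csat_iff [Nonempty V] {C : CGraph K V} {C' : CGraph K W} (h : CIso C C')
    (φ : CForm K 0) : CSat C φ ↔ CSat C' φ :=
  (h.backForth φ.depth).csat_iff le_rfl

lemma exists_conj {n d : ℕ} {ι : Type} [Finite ι] [Nonempty ι] (φ : ι → CForm K n)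
    (hφ : ∀ i, (φ i).depth ≤ d) : ∃ ψ : CForm K n, ψ.depth ≤ d ∧
      ∀ (W : Type) (C : CGraph K W) (g : Fin n → W),
        ψ.Realize C g ↔ ∀ i, (φ i).Realize C g := by
  have := Fintype.ofFinite ι
  suffices ∀ s : Finset ι, s.Nonempty → ∃ ψ : CForm K n, ψ.depth ≤ d ∧
      ∀ (W : Type) (C : CGraph K W) (g : Fin n → W),
        ψ.Realize C g ↔ ∀ i ∈ s, (φ i).Realize C g by
    simpa using this Finset.univ Finset.univ_nonempty
  intro s hs
  induction hs using Finset.Nonempty.cons_induction with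
  | singleton i => exact ⟨φ i, hφ i, by simp⟩
  | cons i s hi hs ih =>
    obtain ⟨ψ, h₁, h₂⟩ := ih
    exact ⟨.conj (φ i) ψ, max_le (hφ i) h₁, fun W C g => by simp [CForm.Realize, h₂]⟩

lemma exists_disj {n d : ℕ} {ι : Type} [Finite ι] [Nonempty ι] (φ : ι → CForm K n)
    (hφ : ∀ i, (φ i).depth ≤ d) : ∃ ψ : CForm K n, ψ.depth ≤ d ∧
      ∀ (W : Type) (C : CGraph K W) (g : Fin n → W),
        ψ.Realize C g ↔ ∃ i, (φ i).Realize C g := by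
  obtain ⟨ψ, h₁, h₂⟩ := exists_conj (fun i => (φ i).neg) hφ
  exact ⟨ψ.neg, h₁, fun W C g => by simp [CForm.Realize, h₂]⟩

/-- The atomic formulas with free variables `x_0, …, x_{n-1}`. -/
def atom {n : ℕ} : (Fin n × Fin n) ⊕ (Fin n × Fin n) ⊕ (Fin K × Fin n) → CForm K n
  | .inl p => .eq p.1 p.2
  | .inr (.inl p) => .adj p.1 p.2
  | .inr (.inr p) => .col p.1 p.2

lemma partialIso_iff_atom {C : CGraph K V} {C' : CGraph K W} {n : ℕ} (f : Fin n → V)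
    (g : Fin n → W) : PartialIso C C' (Set.range fun i => (f i, g i)) ↔
      ∀ a, ((atom a : CForm K n).Realize C f ↔ (atom a).Realize C' g) := by
  constructor
  · rintro h (⟨i, j⟩ | ⟨i, j⟩ | ⟨c, i⟩)
    · exact (h _ ⟨i, rfl⟩ _ ⟨j, rfl⟩).1
    · exact (h _ ⟨i, rfl⟩ _ ⟨j, rfl⟩).2.1
    · exact (h _ ⟨i, rfl⟩ _ ⟨i, rfl⟩).2.2 c
  · rintro h _ ⟨i, rfl⟩ _ ⟨j, rfl⟩
    exact ⟨h (.inl (i, j)), h (.inr (.inl (i, j))), fun c => h (.inr (.inr (c, i)))⟩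

/-- Hintikka formulas: the result of the `k`-round game is expressible in quantifier depth `k`. -/
theorem exists_hintikka [Finite V] [Nonempty V] (C : CGraph K V) (k : ℕ) :
    ∀ (n : ℕ) (f : Fin n → V), 0 < k + n → ∃ φ : CForm K n, φ.depth ≤ k ∧
      ∀ (W : Type) (C' : CGraph K W) (g : Fin n → W), φ.Realize C' g ↔
        BackForth (PartialIso C C') k (Set.range fun i => (f i, g i)) := by
  classical
  induction k with
  | zero =>
    intro n f hn
    have : Nonempty ((Fin n × Fin n) ⊕ (Fin n × Fin n) ⊕ (Fin K × Fin n)) :=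
      ⟨.inl (⟨0, by omega⟩, ⟨0, by omega⟩)⟩
    obtain ⟨ψ, h₁, h₂⟩ := exists_conj (d := 0)
      (fun a : (Fin n × Fin n) ⊕ (Fin n × Fin n) ⊕ (Fin K × Fin n) =>
        if (atom a : CForm K n).Realize C f then atom a else (atom a).neg)
      (by rintro (⟨i, j⟩ | ⟨i, j⟩ | ⟨c, i⟩) <;> split_ifs <;> simp [atom, CForm.depth])
    refine ⟨ψ, h₁, fun W C' g => ?_⟩
    rw [h₂, BackForth, partialIso_iff_atom]
    refine forall_congr' fun a => ?_
    split_ifs with h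
    · simp [h]
    · simp [h, CForm.Realize]
  | succ k ih =>
    intro n f _
    choose φ h₁ h₂ using fun v => ih (n + 1) (Fin.snoc f v) (by omega)
    obtain ⟨ψ, hψ₁, hψ₂⟩ := exists_conj (d := k + 1) (fun v => (φ v).ex)
      (fun v => by simpa [CForm.depth] using h₁ v)
    obtain ⟨χ, hχ₁, hχ₂⟩ := exists_disj φ h₁
    refine ⟨.conj ψ χ.fa, by simp [CForm.depth, hψ₁, hχ₁], fun W C' g => ?_⟩
    simp only [CForm.Realize, hψ₂, hχ₂, h₂, range_snoc_pair, BackForth]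

/-- If Spoiler wins the `k`-round game on `C` and any non-isomorphic finite colored graph, then
`C` is definable in quantifier depth `k`. -/
theorem exists_cdefines [Finite V] [Nonempty V] (C : CGraph K V) {k : ℕ} (hk : 0 < k)
    (h : ∀ (m : ℕ) (C' : CGraph K (Fin m)), BackForth (PartialIso C C') k ∅ → CIso C C') :
    ∃ φ : CForm K 0, φ.depth ≤ k ∧ CDefines C φ := by
  obtain ⟨φ, h₁, h₂⟩ := exists_hintikka C k 0 ![] (by omega)
  have hr : ∀ {W : Type} (g : Fin 0 → W), Set.range (fun i => ((![] : Fin 0 → V) i, g i)) = ∅ :=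
    fun g => Set.range_eq_empty _
  refine ⟨φ, h₁, ?_, fun m C' hC' => h m C' ?_⟩
  · rw [CSat, h₂, hr]
    exact (CIso.refl C).backForth k
  · rwa [CSat, h₂, hr] at hC'

/-- If Duplicator survives `k` rounds on `C` and a non-isomorphic finite colored graph, then
definability of `C` needs quantifier depth more than `k`. -/
theorem lt_depth_of_cdefines {U : Type} [Nonempty V] [Finite W] [Nonempty W]
    {C : CGraph K V} {C' : CGraph K W} {C₀ : CGraph K U} {k : ℕ} (hC₀ : CIso C C₀)
    (h : BackForth (PartialIso C C') k ∅) (hC : ¬ CIso C C') {φ : CForm K 0}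
    (hφ : CDefines C₀ φ) : k < φ.depth := by
  by_contra! hk
  obtain ⟨m, ⟨e⟩⟩ := Finite.exists_equiv_fin W
  let C'' : CGraph K (Fin m) := ⟨C'.graph.comap e.symm, fun c x => C'.color c (e.symm x)⟩
  have hC'' : CIso C' C'' := ⟨e, by simp [C''], by simp [C'']⟩
  have hsat := (hC''.csat_iff φ).1 ((h.csat_iff hk).1 ((hC₀.csat_iff φ).2 hφ.1))
  exact hC (hC₀.trans ((hφ.2 m C'' hsat).trans hC''.symm))

/-- The graph `G` with all edges meeting `A` removed. -/
def avoid (G : SimpleGraph V) (A : Set V) : SimpleGraph V where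
  Adj x y := G.Adj x y ∧ x ∉ A ∧ y ∉ A
  symm := ⟨fun _ _ h => ⟨h.1.symm, h.2.2, h.2.1⟩⟩
  loopless := ⟨fun _ h => h.1.ne rfl⟩

lemma avoid_le (G : SimpleGraph V) (A : Set V) : avoid G A ≤ G := fun _ _ h => h.1

lemma avoid_mono {G H : SimpleGraph V} (hGH : G ≤ H) {A B : Set V} (h : B ⊆ A) :
    avoid G A ≤ avoid H B :=
  fun _ _ h' => ⟨hGH h'.1, fun ha => h'.2.1 (h ha), fun ha => h'.2.2 (h ha)⟩

/-- A partial isomorphism that also preserves connectivity after deleting any of its points. -/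
def StrongIso (C : CGraph K V) (C' : CGraph K W) (P : Set (V × W)) : Prop :=
  PartialIso C C' P ∧ ∀ Q ⊆ P, ∀ p ∈ P, ∀ q ∈ P,
    ((avoid C.graph (Prod.fst '' Q)).Reachable p.1 q.1 ↔
      (avoid C'.graph (Prod.snd '' Q)).Reachable p.2 q.2)

lemma StrongIso.mono {C : CGraph K V} {C' : CGraph K W} : Antitone (StrongIso C C') :=
  fun _ _ h hP => ⟨PartialIso.mono h hP.1,
    fun Q hQ p hp q hq => hP.2 Q (hQ.trans h) p (h hp) q (h hq)⟩

lemma StrongIso.swap {C : CGraph K V} {C' : CGraph K W} (P : Set (V × W))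
    (h : StrongIso C C' P) : StrongIso C' C (Prod.swap '' P) := by
  refine ⟨?_, ?_⟩
  · rintro _ ⟨p, hp, rfl⟩ _ ⟨q, hq, rfl⟩
    have := h.1 p hp q hq
    exact ⟨this.1.symm, this.2.1.symm, fun c => (this.2.2 c).symm⟩
  · rintro Q hQ _ ⟨p, hp, rfl⟩ _ ⟨q, hq, rfl⟩
    have hQ' : Prod.swap '' Q ⊆ P := by
      rintro _ ⟨r, hr, rfl⟩
      obtain ⟨s, hs, rfl⟩ := hQ hr
      simpa using hs
    have := h.2 _ hQ' p hp q hq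
    simp only [Set.image_image, Prod.fst_swap, Prod.snd_swap] at this
    exact this.symm

lemma PartialIso.avoid_adj {C : CGraph K V} {C' : CGraph K W} {P Q : Set (V × W)}
    (h : PartialIso C C' P) (hQ : Q ⊆ P) {p q : V × W} (hp : p ∈ P) (hq : q ∈ P) :
    (avoid C.graph (Prod.fst '' Q)).Adj p.1 q.1 ↔
      (avoid C'.graph (Prod.snd '' Q)).Adj p.2 q.2 := by
  have key : ∀ p ∈ P, p.1 ∈ Prod.fst '' Q ↔ p.2 ∈ Prod.snd '' Q := by
    intro p hp
    constructor
    · rintro ⟨r, hr, hrp⟩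
      exact ⟨r, hr, (h r (hQ hr) p hp).1.1 hrp⟩
    · rintro ⟨r, hr, hrp⟩
      exact ⟨r, hr, (h r (hQ hr) p hp).1.2 hrp⟩
  simp only [avoid, key p hp, key q hq, (h p hp q hq).2.1]

lemma exists_walk_le_one_iff {G : SimpleGraph V} {x y : V} :
    (∃ w : G.Walk x y, w.length ≤ 1) ↔ x = y ∨ G.Adj x y := by
  constructor
  · rintro ⟨w, hw⟩
    cases w with
    | nil => exact .inl rfl
    | cons h w =>
      cases w with
      | nil => exact .inr h
      | cons h' w => simp at hw
  · rintro (rfl | h)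
    · exact ⟨.nil, by simp⟩
    · exact ⟨h.toWalk, by simp⟩

lemma exists_walk_le_add_iff {G : SimpleGraph V} {x y : V} {a b : ℕ} :
    (∃ w : G.Walk x y, w.length ≤ a + b) ↔
      ∃ z, (∃ w : G.Walk x z, w.length ≤ a) ∧ ∃ w : G.Walk z y, w.length ≤ b := by
  constructor
  · rintro ⟨w, hw⟩
    refine ⟨w.getVert a, ⟨w.take a, ?_⟩, ⟨w.drop a, ?_⟩⟩
    · simp [SimpleGraph.Walk.take_length]
    · rw [SimpleGraph.Walk.drop_length]; omega
  · rintro ⟨z, ⟨w, hw⟩, ⟨w', hw'⟩⟩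
    exact ⟨w.append w', by rw [SimpleGraph.Walk.length_append]; omega⟩

/-- Halving: `t` rounds suffice to compare distances up to `2 ^ t`. -/
lemma BackForth.exists_walk_iff [Nonempty V] {C : CGraph K V} {C' : CGraph K W} (t : ℕ) :
    ∀ {P Q : Set (V × W)}, BackForth (PartialIso C C') t P → Q ⊆ P →
      ∀ {p q : V × W}, p ∈ P → q ∈ P →
      ((∃ w : (avoid C.graph (Prod.fst '' Q)).Walk p.1 q.1, w.length ≤ 2 ^ t) ↔
        ∃ w : (avoid C'.graph (Prod.snd '' Q)).Walk p.2 q.2, w.length ≤ 2 ^ t) := by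
  induction t with
  | zero =>
    intro P Q h hQ p q hp hq
    simp only [pow_zero, exists_walk_le_one_iff]
    exact or_congr (h p hp q hq).1 (PartialIso.avoid_adj h hQ hp hq)
  | succ t ih =>
    intro P Q h hQ p q hp hq
    simp only [pow_succ, mul_two, exists_walk_le_add_iff]
    constructor
    · rintro ⟨z, h₁, h₂⟩
      obtain ⟨z', hz⟩ := h.1 z
      have hs : P ⊆ insert (z, z') P := Set.subset_insert _ _
      exact ⟨z', (ih hz (hQ.trans hs) (q := (z, z')) (hs hp) (Set.mem_insert _ _)).1 h₁,
        (ih hz (hQ.trans hs) (p := (z, z')) (Set.mem_insert _ _) (hs hq)).1 h₂⟩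
    · rintro ⟨z', h₁, h₂⟩
      obtain ⟨z, hz⟩ := h.2 z'
      have hs : P ⊆ insert (z, z') P := Set.subset_insert _ _
      exact ⟨z, (ih hz (hQ.trans hs) (q := (z, z')) (hs hp) (Set.mem_insert _ _)).2 h₁,
        (ih hz (hQ.trans hs) (p := (z, z')) (Set.mem_insert _ _) (hs hq)).2 h₂⟩

lemma exists_walk_le_of_reachable [Finite V] {G : SimpleGraph V} {x y : V} {N : ℕ}
    (hN : Nat.card V ≤ N) (h : G.Reachable x y) : ∃ w : G.Walk x y, w.length ≤ N := by
  classical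
  have := Fintype.ofFinite V
  obtain ⟨w⟩ := h
  refine ⟨w.bypass, ?_⟩
  have := w.bypass_isPath.length_lt
  rw [← Nat.card_eq_fintype_card] at this
  omega

lemma BackForth.strongIso_of_card_le [Finite V] [Nonempty V] {C : CGraph K V}
    {C' : CGraph K W} {t : ℕ} (ht : Nat.card V ≤ 2 ^ t) (P : Set (V × W))
    (h : BackForth (PartialIso C C') (t + 2) P) : StrongIso C C' P := by
  have hmono : Antitone (PartialIso C C') := PartialIso.mono
  refine ⟨h.base hmono, fun Q hQ p hp q hq => ?_⟩
  have ht' := h.of_le hmono (show t ≤ t + 2 by omega)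
  constructor
  · intro hr
    obtain ⟨w, -⟩ := (ht'.exists_walk_iff t hQ hp hq).1 (exists_walk_le_of_reachable ht hr)
    exact ⟨w⟩
  · intro hr
    suffices ∀ z', (avoid C'.graph (Prod.snd '' Q)).Reachable p.2 z' →
        ∃ w : (avoid C'.graph (Prod.snd '' Q)).Walk p.2 z', w.length ≤ 2 ^ t by
      obtain ⟨w, -⟩ := (ht'.exists_walk_iff t hQ hp hq).2 (this _ hr)
      exact ⟨w⟩
    intro z' hz'
    rw [SimpleGraph.reachable_iff_reflTransGen] at hz'
    induction hz' with
    | refl => exact ⟨.nil, by simp⟩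
    | @tail y' z' _ hadj ih =>
      obtain ⟨y, hy⟩ := h.2 y'
      obtain ⟨z, hz⟩ := hy.2 z'
      have hs : P ⊆ insert (z, z') (insert (y, y') P) :=
        (Set.subset_insert _ _).trans (Set.subset_insert _ _)
      have hym : (y, y') ∈ insert (z, z') (insert (y, y') P) := by simp
      have hzm : (z, z') ∈ insert (z, z') (insert (y, y') P) := by simp
      obtain ⟨w, -⟩ := (hz.exists_walk_iff t (hQ.trans hs) (hs hp) hym).2 ih
      have hadj' := ((hz.base hmono).avoid_adj (hQ.trans hs) hym hzm).2 hadj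
      exact (hz.exists_walk_iff t (hQ.trans hs) (hs hp) hzm).1
        (exists_walk_le_of_reachable ht (w.reachable.trans hadj'.reachable))

lemma BackForth.strongIso [Finite V] [Nonempty V] {C : CGraph K V}
    {C' : CGraph K W} {t k : ℕ} (ht : Nat.card V ≤ 2 ^ t) {P : Set (V × W)}
    (h : BackForth (PartialIso C C') (k + (t + 2)) P) : BackForth (StrongIso C C') k P :=
  h.of_add.imp (fun P hP => hP.strongIso_of_card_le ht P) k P

/-- The vertices reachable from `w` without passing through `v`. -/
def branchSet (G : SimpleGraph V) (v w : V) : Set V := {x | (avoid G {v}).Reachable w x}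

/-- The branch at `v` containing `w`, with the neighbours of `v` marked by an extra color. -/
def branch (C : CGraph K V) (v w : V) : CGraph (K + 1) (branchSet C.graph v w) where
  graph := C.graph.comap Subtype.val
  color := fun c x => (Fin.cons (C.graph.Adj v x) (fun c => C.color c x) : Fin (K + 1) → Prop) c

lemma self_mem_branchSet (G : SimpleGraph V) (v w : V) : w ∈ branchSet G v w :=
  SimpleGraph.Reachable.refl _

lemma mem_branchSet_of_adj {G : SimpleGraph V} {v w x y : V} (hx : x ∈ branchSet G v w)
    (h : G.Adj x y) (hxv : x ≠ v) (hyv : y ≠ v) : y ∈ branchSet G v w :=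
  SimpleGraph.Reachable.trans hx (SimpleGraph.Adj.reachable ⟨h, hxv, hyv⟩)

lemma not_mem_branchSet {G : SimpleGraph V} {v w : V} (h : w ≠ v) : v ∉ branchSet G v w := by
  intro hv
  obtain ⟨p⟩ := SimpleGraph.Reachable.symm hv
  cases p with
  | nil => exact h rfl
  | cons h' _ => exact h'.2.1 rfl

lemma avoid_branch_reachable {C : CGraph K V} {v w : V} (hvw : w ≠ v)
    (A : Set (branchSet C.graph v w)) (x y : branchSet C.graph v w) :
    (avoid (branch C v w).graph A).Reachable x y ↔
      (avoid C.graph (insert v (Subtype.val '' A))).Reachable x.1 y.1 := by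
  constructor
  · have hne : ∀ x : branchSet C.graph v w, x.1 ≠ v :=
      fun x hx => not_mem_branchSet hvw (hx ▸ x.2)
    refine fun h => h.map (⟨Subtype.val, fun {a b} hab => ⟨hab.1, ?_, ?_⟩⟩ :
      avoid (branch C v w).graph A →g avoid C.graph (insert v (Subtype.val '' A)))
    · simpa [hne a] using hab.2.1
    · simpa [hne b] using hab.2.2
  · obtain ⟨y, hy⟩ := y
    intro h
    rw [SimpleGraph.reachable_iff_reflTransGen] at h
    suffices ∀ z, Relation.ReflTransGen (avoid C.graph (insert v (Subtype.val '' A))).Adj x.1 z →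
        ∃ hz : z ∈ branchSet C.graph v w,
          (avoid (branch C v w).graph A).Reachable x ⟨z, hz⟩ from (this y h).2
    intro z hz
    induction hz with
    | refl => exact ⟨x.2, .refl _⟩
    | tail _ hadj ih =>
      obtain ⟨hb, hr⟩ := ih
      obtain ⟨hadj, hb', hc'⟩ := hadj
      simp only [Set.mem_insert_iff, not_or] at hb' hc'
      refine ⟨mem_branchSet_of_adj hb hadj hb'.1 hc'.1, hr.trans (SimpleGraph.Adj.reachable
        ⟨hadj, fun h => hb'.2 ⟨_, h, rfl⟩, fun h => hc'.2 ⟨_, h, rfl⟩⟩)⟩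

/-- A game containing `(v, v')` and `(w, w')` restricts to the branches. -/
lemma BackForth.branch [Nonempty V] {C : CGraph K V} {C' : CGraph K W} {v w : V} {v' w' : W}
    (hvw : w ≠ v) {k : ℕ} (h : BackForth (StrongIso C C') k {(w, w'), (v, v')}) :
    BackForth (StrongIso (branch C v w) (branch C' v' w')) k ∅ := by
  have hmono : Antitone (StrongIso C C') := StrongIso.mono
  have hvw' : w' ≠ v' := fun h' => hvw
    (((h.base hmono).1 (w, w') (by simp) (v, v') (by simp)).1.2 h')
  let lift (P : Set (branchSet C.graph v w × branchSet C'.graph v' w')) : Set (V × W) :=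
    insert (w, w') (insert (v, v') (Prod.map Subtype.val Subtype.val '' P))
  have hinsert : ∀ x y P, lift (insert (x, y) P) = insert (x.1, y.1) (lift P) := by
    intro x y P
    simp only [lift, Set.image_insert_eq, Prod.map_apply]
    rw [Set.insert_comm (v, v'), Set.insert_comm (w, w')]
  have hmem : ∀ x y P, StrongIso C C' (insert (x, y) (lift P)) →
      (x ∈ branchSet C.graph v w ↔ y ∈ branchSet C'.graph v' w') := by
    intro x y P hP
    simpa [branchSet] using
      hP.2 {(v, v')} (by simp [lift]) (w, w') (by simp [lift]) (x, y) (by simp)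
  suffices ∀ P, BackForth (StrongIso C C') k (lift P) →
      BackForth (StrongIso (FODef.branch C v w) (FODef.branch C' v' w')) k P from
    this ∅ (by simpa [lift] using h)
  clear h
  induction k with
  | zero =>
    intro P hP
    have hl : ∀ p ∈ P, (p.1.1, p.2.1) ∈ lift P := fun p hp => by
      simp only [lift, Set.mem_insert_iff]
      exact .inr (.inr ⟨p, hp, rfl⟩)
    have hv : (v, v') ∈ lift P := by simp [lift]
    refine ⟨fun p hp q hq => ?_, fun Q hQ p hp q hq => ?_⟩
    · have := hP.1 _ (hl p hp) _ (hl q hq)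
      refine ⟨by simpa [Subtype.ext_iff] using this.1, this.2.1, ?_⟩
      have h' := hP.1 _ hv _ (hl p hp)
      refine Fin.cases ?_ ?_
      · simpa [FODef.branch] using h'.2.1
      · simpa [FODef.branch] using this.2.2
    · rw [avoid_branch_reachable hvw, avoid_branch_reachable hvw']
      have := hP.2 (insert (v, v') (Prod.map Subtype.val Subtype.val '' Q))
        (Set.insert_subset hv (by
          rintro _ ⟨r, hr, rfl⟩
          exact hl r (hQ hr))) _ (hl p hp) _ (hl q hq)
      simpa [Set.image_insert_eq, Set.image_image] using this
  | succ k ih =>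
    intro P hP
    refine ⟨fun x => ?_, fun y => ?_⟩
    · obtain ⟨y, hy⟩ := hP.1 x.1
      refine ⟨⟨y, (hmem _ _ P (hy.base hmono)).1 x.2⟩, ih _ ?_⟩
      rwa [hinsert]
    · obtain ⟨x, hx⟩ := hP.2 y.1
      refine ⟨⟨x, (hmem _ _ P (hx.base hmono)).2 y.2⟩, ih _ ?_⟩
      rwa [hinsert]

/-- Distinct neighbours of `v` lie in distinct components after deleting `v`. -/
def SeparatesAt (G : SimpleGraph V) (v : V) : Prop :=
  ∀ ⦃a b⦄, G.Adj v a → G.Adj v b → (avoid G {v}).Reachable a b → a = b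

lemma separatesAt_of_isAcyclic {G : SimpleGraph V} (hG : G.IsAcyclic) (v : V) :
    SeparatesAt G v := by
  classical
  intro a b ha hb h
  by_contra hab
  obtain ⟨p⟩ := h
  have hp : v ∉ (p.mapLe (avoid_le G {v})).bypass.support := by
    intro hv
    have hv : v ∈ p.support := by
      simpa using (p.mapLe (avoid_le G {v})).support_bypass_subset_support hv
    have : v ∈ branchSet G v a := ⟨p.takeUntil v hv⟩
    exact not_mem_branchSet ha.ne' this
  have hq : (SimpleGraph.Walk.cons ha.symm hb.toWalk).IsPath := by
    simp [SimpleGraph.Walk.cons_isPath_iff, hb.ne, ha.ne', hab]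
  have := (hG.subsingleton_path a b).elim
    ⟨_, (p.mapLe (avoid_le G {v})).bypass_isPath⟩ ⟨_, hq⟩
  rw [Subtype.mk.injEq] at this
  rw [this] at hp
  simp at hp

lemma exists_mem_branchSet {G : SimpleGraph V} {v x : V} (h : G.Reachable v x) (hx : x ≠ v) :
    ∃ y, G.Adj v y ∧ x ∈ branchSet G v y := by
  classical
  obtain ⟨p, hp⟩ := h.exists_isPath
  cases p with
  | nil => exact absurd rfl hx
  | @cons _ y _ h p =>
    rw [SimpleGraph.Walk.cons_isPath_iff] at hp
    refine ⟨y, h, ⟨p.transfer (avoid G {v}) fun e he => ?_⟩⟩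
    induction e using Sym2.ind with
    | _ a b =>
      refine ⟨p.adj_of_mem_edges he, ?_, ?_⟩
      · rintro rfl
        exact hp.2 (p.fst_mem_support_of_mem_edges he)
      · rintro rfl
        exact hp.2 (p.snd_mem_support_of_mem_edges he)

lemma SeparatesAt.eq_of_mem {G : SimpleGraph V} {v a b x : V} (h : SeparatesAt G v)
    (ha : G.Adj v a) (hb : G.Adj v b) (hxa : x ∈ branchSet G v a) (hxb : x ∈ branchSet G v b) :
    a = b :=
  h ha hb (SimpleGraph.Reachable.trans hxa (SimpleGraph.Reachable.symm hxb))

lemma SeparatesAt.branch {C : CGraph K V} {v w : V} (hvw : w ≠ v)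
    {x : branchSet C.graph v w} (h : SeparatesAt C.graph x.1) :
    SeparatesAt (branch C v w).graph x := by
  intro a b ha hb hr
  rw [avoid_branch_reachable hvw] at hr
  exact Subtype.ext (h ha hb (hr.mono (avoid_mono le_rfl (by simp))))

lemma connected_branch (C : CGraph K V) {v w : V} (hvw : w ≠ v) :
    (branch C v w).graph.Connected := by
  have : Nonempty (branchSet C.graph v w) := ⟨⟨w, self_mem_branchSet _ _ _⟩⟩
  refine ⟨fun x y => ?_⟩
  refine ((avoid_branch_reachable hvw ∅ x y).2 ?_).mono (avoid_le _ _)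
  simpa using SimpleGraph.Reachable.trans (SimpleGraph.Reachable.symm x.2) y.2

lemma deg_branch_le [Finite V] (C : CGraph K V) (v w : V) (x : branchSet C.graph v w) :
    deg (branch C v w).graph x ≤ deg C.graph x.1 :=
  Nat.card_le_card_of_injective
    (fun y : {y // (branch C v w).graph.Adj x y} => (⟨y.1.1, y.2⟩ : {y // C.graph.Adj x.1 y}))
    fun _ _ h => Subtype.ext (Subtype.ext (Subtype.mk.inj h))

/-- A vertex together with its branches makes up the whole graph. -/
noncomputable def branchEquiv {G : SimpleGraph V} (hG : G.Connected) {v : V}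
    (hv : SeparatesAt G v) : Option (Σ w : {w // G.Adj v w}, branchSet G v w) ≃ V :=
  Equiv.ofBijective (fun x => x.elim v fun y => y.2.1) <| by
    constructor
    · have hne : ∀ y : Σ w : {w // G.Adj v w}, branchSet G v w, y.2.1 ≠ v :=
        fun y h => not_mem_branchSet y.1.2.ne' (h ▸ y.2.2)
      rintro (_ | ⟨a, x⟩) (_ | ⟨b, y⟩) h
      · rfl
      · exact absurd h.symm (hne _)
      · exact absurd h (hne _)
      · change x.1 = y.1 at h
        obtain rfl : a = b := Subtype.ext (hv.eq_of_mem a.2 b.2 x.2 (h ▸ y.2))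
        rw [Subtype.ext h]
    · intro x
      by_cases hx : x = v
      · exact ⟨none, hx.symm⟩
      · obtain ⟨y, hy, hxy⟩ := exists_mem_branchSet (hG v x) hx
        exact ⟨some ⟨⟨y, hy⟩, x, hxy⟩, rfl⟩

@[simp] lemma branchEquiv_none {G : SimpleGraph V} (hG : G.Connected) {v : V}
    (hv : SeparatesAt G v) : branchEquiv hG hv none = v := rfl

@[simp] lemma branchEquiv_some {G : SimpleGraph V} (hG : G.Connected) {v : V}
    (hv : SeparatesAt G v) (w : {w // G.Adj v w}) (x : branchSet G v w) :
    branchEquiv hG hv (some ⟨w, x⟩) = x := rfl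

lemma SeparatesAt.adj_iff {G : SimpleGraph V} {v : V} (hv : SeparatesAt G v)
    (a b : {w // G.Adj v w}) (x : branchSet G v a) (y : branchSet G v b) :
    G.Adj x.1 y.1 ↔ ∃ h : a = b, G.Adj (h ▸ x : branchSet G v b).1 y.1 := by
  constructor
  · intro h
    have hx := mem_branchSet_of_adj x.2 h (fun h => not_mem_branchSet a.2.ne' (h ▸ x.2))
      (fun h => not_mem_branchSet b.2.ne' (h ▸ y.2))
    obtain rfl : a = b := Subtype.ext (hv.eq_of_mem a.2 b.2 hx y.2)
    exact ⟨rfl, h⟩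
  · rintro ⟨rfl, h⟩
    exact h

/-- Colored graphs are isomorphic if their branches at given vertices can be matched. -/
lemma cIso_of_branches {C : CGraph K V} {C' : CGraph K W} (hC : C.graph.Connected)
    (hC' : C'.graph.Connected) {v : V} {v' : W} (hv : SeparatesAt C.graph v)
    (hv' : SeparatesAt C'.graph v') (hcol : ∀ c, C.color c v ↔ C'.color c v')
    (σ : {w // C.graph.Adj v w} ≃ {w // C'.graph.Adj v' w})
    (hσ : ∀ w : {w // C.graph.Adj v w}, CIso (branch C v w) (branch C' v' (σ w))) : CIso C C' := by
  choose ε h₁ h₂ using hσ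
  let Φ := Equiv.optionCongr (Equiv.sigmaCongr
    (β₁ := fun w : {w // C.graph.Adj v w} => branchSet C.graph v w)
    (β₂ := fun w : {w // C'.graph.Adj v' w} => branchSet C'.graph v' w) σ ε)
  have hnone : Φ none = none := rfl
  have hsome : ∀ a x, Φ (some ⟨a, x⟩) = some ⟨σ a, ε a x⟩ := fun _ _ => rfl
  suffices (∀ a b, C.graph.Adj (branchEquiv hC hv a) (branchEquiv hC hv b) ↔
      C'.graph.Adj (branchEquiv hC' hv' (Φ a)) (branchEquiv hC' hv' (Φ b))) ∧
      ∀ c a, C.color c (branchEquiv hC hv a) ↔ C'.color c (branchEquiv hC' hv' (Φ a)) by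
    refine ⟨((branchEquiv hC hv).symm.trans Φ).trans (branchEquiv hC' hv'), fun x y => ?_,
      fun c x => ?_⟩
    · simpa using this.1 ((branchEquiv hC hv).symm x) ((branchEquiv hC hv).symm y)
    · simpa using this.2 c ((branchEquiv hC hv).symm x)
  have hroot : ∀ (w : {w // C.graph.Adj v w}) (x : branchSet C.graph v w),
      C.graph.Adj v x ↔ C'.graph.Adj v' (ε w x) := fun w x => by
    simpa [branch] using h₂ w 0 x
  refine ⟨?_, ?_⟩
  · rintro (_ | ⟨a, x⟩) (_ | ⟨b, y⟩)
    · simp [hnone]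
    · simpa [hnone, hsome] using hroot b y
    · simpa [hnone, hsome, SimpleGraph.adj_comm] using hroot a x
    · rw [hsome, hsome]
      simp only [branchEquiv_some]
      rw [hv.adj_iff, hv'.adj_iff]
      constructor
      · rintro ⟨rfl, h⟩
        exact ⟨rfl, (h₁ a x y).1 h⟩
      · rintro ⟨h, h'⟩
        obtain rfl := σ.injective h
        exact ⟨rfl, (h₁ a x y).2 h'⟩
  · rintro c (_ | ⟨a, x⟩)
    · simpa [hnone] using hcol c
    · simpa [hsome, branch] using h₂ a c.succ x

lemma disjoint_branchSet {G : SimpleGraph V} {v w : V} (hv : SeparatesAt G v)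
    (h : G.Adj v w) : Disjoint (branchSet G v w) (branchSet G w v) := by
  rw [Set.disjoint_left]
  intro x hx hx'
  obtain ⟨y, hvy, hxy⟩ := exists_mem_branchSet (G := avoid G {w}) hx'
    (fun e => not_mem_branchSet h.ne' (e ▸ hx))
  have hxy' : x ∈ branchSet G v y :=
    SimpleGraph.Reachable.mono (avoid_mono (avoid_le G {w}) le_rfl) hxy
  obtain rfl := hv.eq_of_mem h hvy.1 hx hxy'
  exact hvy.2.2 rfl

lemma branchSet_subset {G : SimpleGraph V} {v w u : V} (hw : SeparatesAt G w)
    (hvw : G.Adj v w) (hwu : G.Adj w u) (huv : u ≠ v) :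
    branchSet G w u ⊆ branchSet G v w := by
  intro x hx
  have hne : ∀ z ∈ branchSet G w u, z ≠ v := by
    rintro z hz rfl
    exact huv (hw hwu hvw.symm hz)
  have hx' : (avoid G {w}).Reachable u x := hx
  rw [SimpleGraph.reachable_iff_reflTransGen] at hx'
  induction hx' with
  | refl => exact SimpleGraph.Adj.reachable ⟨hwu, hvw.ne', huv⟩
  | @tail y z hy hyz ih =>
    have hy' : y ∈ branchSet G w u := (SimpleGraph.reachable_iff_reflTransGen _ _).2 hy
    exact mem_branchSet_of_adj (ih hy') hyz.1 (hne y hy') (hne z hx)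

/-- A finite tree has a centroid. -/
lemma exists_centroid [Finite V] [Nonempty V] {G : SimpleGraph V}
    (hG : ∀ v, SeparatesAt G v) :
    ∃ v, ∀ w, G.Adj v w → 2 * (branchSet G v w).ncard ≤ Nat.card V := by
  by_contra! h
  choose g hg hlt using h
  obtain ⟨v, hv⟩ := Finite.exists_min fun v => (branchSet G v (g v)).ncard
  by_cases hgv : g (g v) = v
  · have h₁ := hlt v
    have h₂ := hlt (g v)
    have h₃ := Set.ncard_union_eq (disjoint_branchSet (hG v) (hg v))
    have h₄ := Set.ncard_le_card (branchSet G v (g v) ∪ branchSet G (g v) v)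
    rw [hgv] at h₂
    omega
  · have hss : branchSet G (g v) (g (g v)) ⊂ branchSet G v (g v) := by
      refine (branchSet_subset (hG _) (hg v) (hg _) hgv).ssubset_of_mem_notMem
        (self_mem_branchSet _ _ _) (not_mem_branchSet (hg _).ne')
    exact (hv (g v)).not_gt (Set.ncard_lt_ncard hss)

lemma CIso.separatesAt {C : CGraph K V} {C' : CGraph K W} (h : CIso C C')
    (hC : ∀ v, SeparatesAt C.graph v) (v' : W) : SeparatesAt C'.graph v' := by
  obtain ⟨e, he, -⟩ := h
  intro a b ha hb hab
  refine e.symm.injective (hC (e.symm v') ((he _ _).2 (by simpa)) ((he _ _).2 (by simpa)) ?_)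
  refine hab.map (⟨e.symm, fun {x y} hxy => ⟨(he _ _).2 (by simpa using hxy.1), ?_, ?_⟩⟩ :
    avoid C'.graph {v'} →g avoid C.graph {e.symm v'})
  · simpa using hxy.2.1
  · simpa using hxy.2.2

lemma CIso.deg_le {C : CGraph K V} {C' : CGraph K W} (h : CIso C C') {l : ℕ}
    (hC : ∀ v, deg C.graph v ≤ l) (v' : W) : deg C'.graph v' ≤ l := by
  obtain ⟨e, he, -⟩ := h
  refine le_trans (le_of_eq (Nat.card_congr ?_)) (hC (e.symm v'))
  exact (e.subtypeEquiv fun w => by simp [he]).symm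

lemma CIso.card_eq {C : CGraph K V} {C' : CGraph K W} (h : CIso C C') :
    Nat.card V = Nat.card W := by
  obtain ⟨e, -⟩ := h
  exact Nat.card_congr e

/-- If Spoiler pebbles distinct neighbours of `v`, Duplicator has to answer by distinct neighbours
of `v'`. -/
lemma BackForth.exists_neighbors [Nonempty V] {C : CGraph K V} {C' : CGraph K W} {v : V}
    {v' : W} (m : ℕ) : ∀ {r : ℕ} {P : Set (V × W)}, (v, v') ∈ P →
      BackForth (StrongIso C C') (r + m) P → ∀ w : Fin m → {w // C.graph.Adj v w},
      w.Injective → ∃ u : Fin m → {w // C'.graph.Adj v' w}, u.Injective ∧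
        ∀ i, BackForth (StrongIso C C') r {((w i).1, (u i).1), (v, v')} := by
  have hmono : Antitone (StrongIso C C') := StrongIso.mono
  suffices ∀ {r : ℕ} {P : Set (V × W)}, (v, v') ∈ P →
      BackForth (StrongIso C C') (r + m) P → ∀ w : Fin m → {w // C.graph.Adj v w},
      w.Injective → ∃ u : Fin m → {w // C'.graph.Adj v' w}, u.Injective ∧
        ∀ i, BackForth (StrongIso C C') r (insert ((w i).1, (u i).1) P) by
    intro r P hP h w hw
    obtain ⟨u, hu, hu'⟩ := this hP h w hw
    exact ⟨u, hu, fun i => (hu' i).mono hmono _ (Set.insert_subset_insert (by simpa))⟩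
  induction m with
  | zero => exact fun _ _ _ _ => ⟨Fin.elim0, fun i => i.elim0, fun i => i.elim0⟩
  | succ m ih =>
    intro r P hP h w hw
    obtain ⟨y, hy⟩ := h.1 (w 0).1
    have hadj : C'.graph.Adj v' y := ((hy.base hmono).1 (v, v') (by simp [hP])
      ((w 0).1, y) (by simp)).2.1.1 (w 0).2
    obtain ⟨u, hu, hu'⟩ := ih (Set.mem_insert_of_mem _ hP) hy (fun i => w i.succ)
      (hw.comp (Fin.succ_injective m))
    refine ⟨Fin.cons ⟨y, hadj⟩ u, ?_, fun i => ?_⟩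
    · rw [Fin.cons_injective_iff]
      refine ⟨?_, hu⟩
      rintro ⟨i, hi⟩
      have h0 := ((hu' i).base hmono).1 ((w i.succ).1, (u i).1) (by simp) ((w 0).1, y) (by simp)
      exact Fin.succ_ne_zero i (hw (Subtype.ext (h0.1.2 (by rw [hi]))))
    · induction i using Fin.cases with
      | zero => exact hy.of_le hmono (Nat.le_add_right r m)
      | succ i => exact (hu' i).mono hmono _ (Set.insert_subset_insert (Set.subset_insert _ _))

lemma BackForth.connected [Nonempty V] {C : CGraph K V} {C' : CGraph K W}
    (h : BackForth (StrongIso C C') 2 ∅) (hC : C.graph.Connected) : C'.graph.Connected := by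
  have : Nonempty W := ⟨(h.1 (Classical.arbitrary V)).choose⟩
  refine ⟨fun x' y' => ?_⟩
  obtain ⟨x, hx⟩ := h.2 x'
  obtain ⟨y, hy⟩ := hx.2 y'
  refine SimpleGraph.Reachable.mono (avoid_le _ _) ((hy.2 ∅ (Set.empty_subset _) (x, x') (by simp)
    (y, y') (by simp)).1 ((hC x y).mono fun a b h => ⟨h, by simp, by simp⟩))

lemma BackForth.separatesAt {C : CGraph K V} {C' : CGraph K W} {v : V}
    {v' : W} (h : BackForth (StrongIso C C') 2 {(v, v')}) (hC : SeparatesAt C.graph v) :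
    SeparatesAt C'.graph v' := by
  intro a' b' ha hb hab
  obtain ⟨a, h⟩ := h.2 a'
  obtain ⟨b, h⟩ := h.2 b'
  refine (h.1 (a, a') (by simp) (b, b') (by simp)).1.1 (hC ?_ ?_ ?_)
  · exact (h.1 (v, v') (by simp) (a, a') (by simp)).2.1.2 ha
  · exact (h.1 (v, v') (by simp) (b, b') (by simp)).2.1.2 hb
  · simpa using (h.2 {(v, v')} (by simp) (a, a') (by simp) (b, b') (by simp)).2 (by simpa using hab)

lemma BackForth.swap_pair {C : CGraph K V} {C' : CGraph K W} {v : V} {v' : W} {k : ℕ}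
    (h : BackForth (StrongIso C C') k {(v, v')}) : BackForth (StrongIso C' C) k {(v', v)} := by
  simpa using BackForth.swap StrongIso.swap k _ h

lemma BackForth.deg_le [Nonempty V] [Finite V] [Finite W] {C : CGraph K V} {C' : CGraph K W}
    {v : V} {v' : W} {k m : ℕ} (h : BackForth (StrongIso C C') k {(v, v')})
    (hm : m ≤ deg C.graph v) (hk : m ≤ k) : m ≤ deg C'.graph v' := by
  have := Fintype.ofFinite {w // C.graph.Adj v w}
  rw [deg, Nat.card_eq_fintype_card, ← Fintype.card_fin m] at hm
  obtain ⟨w⟩ := Function.Embedding.nonempty_of_card_le hm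
  obtain ⟨u, hu, -⟩ := BackForth.exists_neighbors (r := k - m) (P := {(v, v')}) m rfl
    (by rwa [Nat.sub_add_cancel hk]) w w.injective
  simpa [deg] using Nat.card_le_card_of_injective u hu

open Finset in
/-- If two finite families of types cannot be matched, then some type occurs more often in the
second one. -/
lemma exists_fiber_lt {α β : Type} {ι : Type*} [Fintype α] [Fintype β] [DecidableEq ι]
    (f : α → ι) (g : β → ι) (hc : Fintype.card α ≤ Fintype.card β)
    (h : ¬ ∃ σ : α ≃ β, ∀ x, g (σ x) = f x) : ∃ q, #{x | f x = q} < #{x | g x = q} := by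
  by_contra! hle
  refine h ?_
  have heq : ∀ q, #{x | g x = q} = #{x | f x = q} := by
    let t := univ.image f ∪ univ.image g
    have h₁ : Fintype.card α = ∑ q ∈ t, #{x | f x = q} :=
      card_eq_sum_card_fiberwise fun x _ => by simp [t]
    have h₂ : Fintype.card β = ∑ q ∈ t, #{x | g x = q} :=
      card_eq_sum_card_fiberwise fun x _ => by simp [t]
    have h₃ := (sum_eq_sum_iff_of_le fun q (_ : q ∈ t) => hle q).1
      (le_antisymm (sum_le_sum fun q _ => hle q) (by rw [← h₁, ← h₂]; exact hc))
    intro q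
    by_cases hq : q ∈ t
    · exact h₃ q hq
    · have h₄ : #{x | f x = q} = 0 := by
        simp only [t, mem_union, mem_image, not_or, not_exists] at hq
        simpa [filter_eq_empty_iff] using hq.1
      have := hle q
      omega
  have e : ∀ q, {x // f x = q} ≃ {x // g x = q} := fun q => Fintype.equivOfCardEq (by
    rw [Fintype.card_subtype, Fintype.card_subtype, heq])
  refine ⟨((Equiv.sigmaFiberEquiv f).symm.trans (Equiv.sigmaCongrRight e)).trans
    (Equiv.sigmaFiberEquiv g), fun x => (e (f x) ⟨x, rfl⟩).2⟩

open Finset in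
lemma card_mul_ncard_branchSet_le [Finite V] {G : SimpleGraph V} (hG : G.Connected) {v : V}
    (hv : SeparatesAt G v) (S : Finset {w // G.Adj v w}) {c : ℕ}
    (hS : ∀ w ∈ S, Nat.card (branchSet G v w) = c) : #S * c ≤ Nat.card V := by
  have := Fintype.ofFinite V
  have := Fintype.ofFinite {w // G.Adj v w}
  have h₁ := Nat.card_congr (branchEquiv hG hv)
  rw [Finite.card_option, Nat.card_sigma] at h₁
  have h₂ : ∑ w ∈ S, Nat.card (branchSet G v w) ≤
      ∑ w : {w // G.Adj v w}, Nat.card (branchSet G v w) :=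
    sum_le_sum_of_subset (subset_univ S)
  rw [sum_congr rfl hS, sum_const, smul_eq_mul] at h₂
  omega

/-- Isomorphism of colored graphs on arbitrary vertex sets, as a setoid. -/
def cIsoSetoid (K : ℕ) : Setoid (Σ X : Type, CGraph K X) where
  r x y := CIso x.2 y.2
  iseqv := ⟨fun x => CIso.refl x.2, CIso.symm, CIso.trans⟩

/-- The isomorphism type of a colored graph. -/
def isoType (C : CGraph K V) : Quotient (cIsoSetoid K) := Quotient.mk _ ⟨V, C⟩

lemma isoType_eq_iff {C : CGraph K V} {C' : CGraph K W} : isoType C = isoType C' ↔ CIso C C' :=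
  ⟨fun h => Quotient.exact h, fun h => Quotient.sound (s := cIsoSetoid K) h⟩

open Finset in
/-- Spoiler's strategy: descend from a centroid into a branch of different isomorphism types,
pebbling all branches of one type. -/
theorem cIso_of_backForth {l : ℕ} {A : ℝ}
    (hA : ∀ m : ℕ, 2 * m ≤ l + 1 → 1 + (m : ℝ) ≤ A * Real.log (max 2 ((m : ℝ) - 1))) (s : ℕ) :
    ∀ (K : ℕ) (V W : Type) [Finite V] [Nonempty V] [Finite W] (C : CGraph K V) (C' : CGraph K W)
      (k : ℕ), Nat.card V = s → C.graph.Connected → (∀ v, SeparatesAt C.graph v) →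
      (∀ v, deg C.graph v ≤ l) → l + 10 + A * Real.log s ≤ k →
      BackForth (StrongIso C C') k ∅ → CIso C C' := by
  classical
  have hA0 : 0 < A := by
    have h := hA 0 (by omega)
    norm_num at h
    exact pos_of_mul_pos_left (by linarith) (Real.log_nonneg (by norm_num : (1 : ℝ) ≤ 2))
  induction s using Nat.strong_induction_on with
  | _ s ih =>
  intro K V W _ _ _ C C' k hs hconn hsep hdeg hk h
  have hmono : Antitone (StrongIso C C') := StrongIso.mono
  have hkl : l + 10 ≤ k := by
    have : 0 ≤ A * Real.log s := mul_nonneg hA0.le (Real.log_natCast_nonneg s)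
    exact_mod_cast (by linarith : (l : ℝ) + 10 ≤ k)
  have hk' : ∀ m s' : ℕ, 2 * m ≤ l + 1 → 0 < s' → 2 * s' ≤ s → (m - 1) * s' ≤ s →
      (l : ℝ) + 10 + A * Real.log s' ≤ (k - 1 - m : ℕ) := by
    intro m s' hm hs' h2 hms
    have hle : max 2 ((m : ℝ) - 1) * s' ≤ s := by
      rw [max_mul_of_nonneg _ _ (Nat.cast_nonneg _)]
      refine max_le (by exact_mod_cast h2) ?_
      have hms' : (((m - 1) * s' : ℕ) : ℝ) ≤ s := Nat.cast_le.2 hms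
      rw [Nat.cast_mul] at hms'
      refine le_trans (mul_le_mul_of_nonneg_right ?_ (Nat.cast_nonneg _)) hms'
      exact tsub_le_iff_right.2 (by exact_mod_cast (by omega : m ≤ m - 1 + 1))
    have hs0 : (0 : ℝ) < s' := by exact_mod_cast hs'
    have hlog := Real.log_le_log (by positivity) hle
    rw [Real.log_mul (by positivity) hs0.ne'] at hlog
    have := mul_le_mul_of_nonneg_left hlog hA0.le
    have := hA m hm
    have : ((k - 1 - m : ℕ) : ℝ) = k - 1 - m := by
      rw [Nat.cast_sub (by omega), Nat.cast_sub (by omega)]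
      simp
    linarith
  obtain ⟨v, hv⟩ := exists_centroid hsep
  obtain ⟨k, rfl⟩ := Nat.exists_eq_add_of_le' (show 1 ≤ k by omega)
  simp only [Nat.add_sub_cancel] at hk'
  obtain ⟨v', hvv⟩ := h.1 v
  simp only [insert_empty_eq] at hvv
  have : Nonempty W := ⟨v'⟩
  have hconn' := BackForth.connected (h.of_le hmono (by omega)) hconn
  have hsep' := BackForth.separatesAt (hvv.of_le hmono (by omega)) (hsep v)
  have hdegeq : deg C.graph v = deg C'.graph v' := by
    have hd := hdeg v
    refine le_antisymm (hvv.deg_le le_rfl (by omega)) ?_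
    by_contra! hlt
    have := hvv.swap_pair.deg_le (Nat.succ_le_of_lt hlt) (by omega)
    omega
  have := Fintype.ofFinite {w // C.graph.Adj v w}
  have := Fintype.ofFinite {w // C'.graph.Adj v' w}
  have hcard : Fintype.card {w // C.graph.Adj v w} = Fintype.card {w // C'.graph.Adj v' w} := by
    simpa [deg] using hdegeq
  let f : {w // C.graph.Adj v w} → Quotient (cIsoSetoid (K + 1)) :=
    fun w => isoType (branch C v w)
  let g : {w // C'.graph.Adj v' w} → Quotient (cIsoSetoid (K + 1)) :=
    fun w => isoType (branch C' v' w)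
  by_contra hiso
  have hσ : ¬ ∃ σ : {w // C.graph.Adj v w} ≃ {w // C'.graph.Adj v' w}, ∀ x, g (σ x) = f x := by
    rintro ⟨σ, hσ⟩
    exact hiso (cIso_of_branches hconn hconn' (hsep v) hsep'
      ((hvv.base hmono).1 _ rfl _ rfl).2.2 σ fun w => isoType_eq_iff.1 (hσ w).symm)
  obtain ⟨q₂, hq₂⟩ := exists_fiber_lt f g hcard.le hσ
  obtain ⟨q₁, hq₁⟩ := exists_fiber_lt g f hcard.ge
    fun ⟨σ, hσ'⟩ => hσ ⟨σ.symm, fun x => by simpa using (hσ' (σ.symm x)).symm⟩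
  have hfiber : ∀ w : {w // C.graph.Adj v w},
      #{x | f x = f w} * Nat.card (branchSet C.graph v w) ≤ s := by
    intro w
    rw [← hs]
    exact card_mul_ncard_branchSet_le hconn (hsep v) _ fun x hx =>
      (isoType_eq_iff.1 (mem_filter.1 hx).2).card_eq
  have hpos : ∀ w : {w // C.graph.Adj v w}, 0 < Nat.card (branchSet C.graph v w) := fun w =>
    have : Nonempty (branchSet C.graph v w) := ⟨w, self_mem_branchSet _ _ _⟩
    Nat.card_pos
  have hhalf : ∀ w : {w // C.graph.Adj v w}, 2 * Nat.card (branchSet C.graph v w) ≤ s := by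
    intro w
    rw [← hs]
    exact hv w w.2
  have hsum : #{x | f x = q₁} + #{x | f x = q₂} ≤ l := by
    rw [← card_union_of_disjoint]
    · refine (card_le_univ _).trans ?_
      simpa [deg] using hdeg v
    · rw [disjoint_filter]
      rintro x - rfl rfl
      exact lt_asymm hq₁ hq₂
  have hbranch : ∀ (w : {w // C.graph.Adj v w}) (X : Type) [Finite X] (B : CGraph (K + 1) X)
      (j : ℕ), l + 10 + A * Real.log (Nat.card (branchSet C.graph v w)) ≤ j →
      BackForth (StrongIso (branch C v w) B) j ∅ → CIso (branch C v w) B := by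
    intro w X _ B j hj hB
    have hw := w.2.ne'
    have : Nonempty (branchSet C.graph v w) := ⟨w, self_mem_branchSet _ _ _⟩
    exact ih _ (by have := hpos w; have := hhalf w; omega) _ _ _ _ B j rfl (connected_branch C hw)
      (fun x => SeparatesAt.branch hw (hsep x)) (fun x => (deg_branch_le C v w x).trans (hdeg x))
      hj hB
  rcases le_or_gt #{x | f x = q₁} (#{x | f x = q₂} + 1) with hle | hlt
  · let w : Fin #{x | f x = q₁} → {w // C.graph.Adj v w} :=
      fun i => (Finset.equivFin {x | f x = q₁}).symm i
    have hw : w.Injective := Subtype.val_injective.comp (Equiv.injective _)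
    have hwq : ∀ i, f (w i) = q₁ := fun i =>
      (mem_filter.1 ((Finset.equivFin {x | f x = q₁}).symm i).2).2
    obtain ⟨u, hu, huv⟩ := BackForth.exists_neighbors (r := k - #{x | f x = q₁})
      (P := {(v, v')}) _ rfl (by rwa [Nat.sub_add_cancel (by omega)]) w hw
    obtain ⟨i, hi⟩ : ∃ i, g (u i) ≠ q₁ := by
      by_contra! hall
      have := card_le_card_of_injOn (s := univ) (t := {x | g x = q₁}) u (by simp [hall]) hu.injOn
      rw [card_univ, Fintype.card_fin] at this
      omega
    have hf := hfiber (w i)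
    rw [hwq] at hf
    refine hi ((isoType_eq_iff.2 (hbranch (w i) _ (branch C' v' (u i)) _
      (hk' #{x | f x = q₁} _ (by omega) (hpos _) (hhalf _) ?_)
      ((huv i).branch (w i).2.ne'))).symm.trans (hwq i))
    exact (Nat.mul_le_mul_right _ (Nat.sub_le _ _)).trans hf
  · let w : Fin #{x | g x = q₂} → {w // C'.graph.Adj v' w} :=
      fun i => (Finset.equivFin {x | g x = q₂}).symm i
    let ι : Fin (#{x | f x = q₂} + 1) → Fin #{x | g x = q₂} := Fin.castLE hq₂
    have hw : (w ∘ ι).Injective := (Subtype.val_injective.comp (Equiv.injective _)).comp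
      (Fin.castLE_injective hq₂)
    have hwq : ∀ i, g (w i) = q₂ := fun i =>
      (mem_filter.1 ((Finset.equivFin {x | g x = q₂}).symm i).2).2
    obtain ⟨u, hu, huv⟩ := BackForth.exists_neighbors (r := k - (#{x | f x = q₂} + 1))
      (P := {(v', v)}) _ rfl (by
        rw [Nat.sub_add_cancel (by omega)]
        exact hvv.swap_pair) (w ∘ ι) hw
    obtain ⟨i, hi⟩ : ∃ i, f (u i) ≠ q₂ := by
      by_contra! hall
      have := card_le_card_of_injOn (s := univ) (t := {x | f x = q₂}) u (by simp [hall]) hu.injOn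
      rw [card_univ, Fintype.card_fin] at this
      omega
    have hb := (huv i).branch (w (ι i)).2.ne'
    rcases Nat.eq_zero_or_pos #{x | f x = q₂} with h0 | h0
    · refine hi ((isoType_eq_iff.2 (hbranch (u i) _ (branch C' v' (w (ι i))) _
        (hk' (#{x | f x = q₂} + 1) _ (by omega) (hpos _) (hhalf _) (by simp [h0])) ?_)).trans
        (hwq (ι i)))
      simpa using BackForth.swap StrongIso.swap _ _ hb
    · obtain ⟨w₁, hw₁⟩ := card_pos.1 h0
      have hw₁ : f w₁ = q₂ := (mem_filter.1 hw₁).2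
      have he : CIso (branch C v w₁) (branch C' v' (w (ι i))) :=
        isoType_eq_iff.1 (hw₁.trans (hwq (ι i)).symm)
      have hf := hfiber w₁
      rw [hw₁] at hf
      have hw₁' := w₁.2.ne'
      have hww := (w (ι i)).2.ne'
      have : Nonempty (branchSet C'.graph v' (w (ι i))) := ⟨w (ι i), self_mem_branchSet _ _ _⟩
      have := ih _ (by have := hpos w₁; have := hhalf w₁; omega) _ _ _ (branch C' v' (w (ι i)))
        (branch C v (u i)) _ he.card_eq.symm (connected_branch C' hww)
        (he.separatesAt fun x => SeparatesAt.branch hw₁' (hsep x))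
        (he.deg_le fun x => (deg_branch_le C v w₁ x).trans (hdeg x))
        (hk' (#{x | f x = q₂} + 1) _ (by omega) (hpos _) (hhalf _) (by simpa using hf)) hb
      exact hi ((isoType_eq_iff.2 this).symm.trans (hwq (ι i)))

/-- A colored tree on at most `2 ^ t` vertices with maximum degree at most `l` is definable in
quantifier depth `k + t + 2` if `k` is large. -/
theorem exists_cdefines_of_isColTree {l : ℕ} {A : ℝ}
    (hA : ∀ m : ℕ, 2 * m ≤ l + 1 → 1 + (m : ℝ) ≤ A * Real.log (max 2 ((m : ℝ) - 1)))
    {m : ℕ} (C : CGraph K (Fin m)) (hC : IsColTree C) (hdeg : ∀ v, deg C.graph v ≤ l) {k t : ℕ}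
    (hk : l + 10 + A * Real.log m ≤ k) (ht : m ≤ 2 ^ t) :
    ∃ φ : CForm K 0, φ.depth ≤ k + (t + 2) ∧ CDefines C φ := by
  have := hC.1.nonempty
  refine exists_cdefines C (by omega) fun m' C' h => ?_
  exact cIso_of_backForth hA m K _ _ C C' k (by simp) hC.1 (separatesAt_of_isAcyclic hC.2) hdeg hk
    (h.strongIso (by simpa using ht))

/-- The graph consisting of `ι` copies of `G`, `κ` copies of `H` and a new vertex adjacent to the
root of each of these copies. -/
def glue (ι κ : Type) (G : SimpleGraph V) (r : V) (H : SimpleGraph W) (s : W) :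
    SimpleGraph (Option ((ι × V) ⊕ (κ × W))) where
  Adj
    | none, some (.inl p) => p.2 = r
    | none, some (.inr p) => p.2 = s
    | some (.inl p), none => p.2 = r
    | some (.inr p), none => p.2 = s
    | some (.inl p), some (.inl q) => p.1 = q.1 ∧ G.Adj p.2 q.2
    | some (.inr p), some (.inr q) => p.1 = q.1 ∧ H.Adj p.2 q.2
    | _, _ => False
  symm := ⟨by
    rintro (_ | p | p) (_ | q | q) h
    · exact h
    · exact h
    · exact h
    · exact h
    · exact ⟨h.1.symm, h.2.symm⟩
    · exact h
    · exact h
    · exact h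
    · exact ⟨h.1.symm, h.2.symm⟩⟩
  loopless := ⟨by
    rintro (_ | p | p) h
    · exact h
    · exact h.2.ne rfl
    · exact h.2.ne rfl⟩

section glue

variable {ι κ : Type} {G : SimpleGraph V} {r : V} {H : SimpleGraph W} {s : W}

@[simp] lemma glue_adj_none_none : ¬ (glue ι κ G r H s).Adj none none := id

@[simp] lemma glue_adj_none_inl {p : ι × V} :
    (glue ι κ G r H s).Adj none (some (.inl p)) ↔ p.2 = r := Iff.rfl

@[simp] lemma glue_adj_none_inr {p : κ × W} :
    (glue ι κ G r H s).Adj none (some (.inr p)) ↔ p.2 = s := Iff.rfl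

@[simp] lemma glue_adj_inl_none {p : ι × V} :
    (glue ι κ G r H s).Adj (some (.inl p)) none ↔ p.2 = r := Iff.rfl

@[simp] lemma glue_adj_inr_none {p : κ × W} :
    (glue ι κ G r H s).Adj (some (.inr p)) none ↔ p.2 = s := Iff.rfl

@[simp] lemma glue_adj_inl_inl {p q : ι × V} :
    (glue ι κ G r H s).Adj (some (.inl p)) (some (.inl q)) ↔ p.1 = q.1 ∧ G.Adj p.2 q.2 := Iff.rfl

@[simp] lemma glue_adj_inr_inr {p q : κ × W} :
    (glue ι κ G r H s).Adj (some (.inr p)) (some (.inr q)) ↔ p.1 = q.1 ∧ H.Adj p.2 q.2 := Iff.rfl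

@[simp] lemma glue_adj_inl_inr {p : ι × V} {q : κ × W} :
    ¬ (glue ι κ G r H s).Adj (some (.inl p)) (some (.inr q)) := id

@[simp] lemma glue_adj_inr_inl {p : κ × W} {q : ι × V} :
    ¬ (glue ι κ G r H s).Adj (some (.inr p)) (some (.inl q)) := id

end glue

/-- Pairs of vertices in two glued graphs that correspond to each other under matchings `e` and `f`
of the copies indexed by `A` and `B`, with the pairs in the two unmatched copies given by `P`. -/
inductive Matched {ι₁ ι₂ κ₁ κ₂ : Type} (e : ι₁ ≃ Option ι₂) (f : κ₂ ≃ Option κ₁) (A : Set ι₁)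
    (B : Set κ₂) (P : Set (V × W)) :
    Option ((ι₁ × V) ⊕ (κ₁ × W)) × Option ((ι₂ × V) ⊕ (κ₂ × W)) → Prop
  | root : Matched e f A B P (none, none)
  | inl {i : ι₁} {i' : ι₂} (x : V) (hi : i ∈ A) (h : e i = some i') :
      Matched e f A B P (some (.inl (i, x)), some (.inl (i', x)))
  | inr {j : κ₁} {j' : κ₂} (y : W) (hj : j' ∈ B) (h : f j' = some j) :
      Matched e f A B P (some (.inr (j, y)), some (.inr (j', y)))
  | unmatched {i : ι₁} {j' : κ₂} {x : V} {y : W} (hi : e i = none) (hj : f j' = none)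
      (h : (x, y) ∈ P) : Matched e f A B P (some (.inl (i, x)), some (.inr (j', y)))

section game

variable {ι₁ ι₂ κ₁ κ₂ : Type} {e e' : ι₁ ≃ Option ι₂} {f f' : κ₂ ≃ Option κ₁}
  {A A' : Set ι₁} {B B' : Set κ₂} {P P' : Set (V × W)}
  {G : SimpleGraph V} {r : V} {H : SimpleGraph W} {s : W}

lemma Matched.mono (hA : A ⊆ A') (hB : B ⊆ B') (he : ∀ i ∈ A, e i = e' i)
    (hf : ∀ j ∈ B, f j = f' j) {p} (h : Matched e f A B ∅ p) : Matched e' f' A' B' P p := by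
  cases h with
  | root => exact .root
  | inl x hi h => exact .inl x (hA hi) (he _ hi ▸ h)
  | inr y hj h => exact .inr y (hB hj) (hf _ hj ▸ h)
  | unmatched _ _ h => exact h.elim

lemma Matched.mono_right (h : P ⊆ P') {p} (hp : Matched e f A B P p) :
    Matched e f A B P' p := by
  cases hp with
  | root => exact .root
  | inl x hi h => exact .inl x hi h
  | inr y hj h => exact .inr y hj h
  | unmatched hi hj hp => exact .unmatched hi hj (h hp)

lemma PartialIso.matched (hP : PartialIso (plain G) (plain H) P) (hr : (r, s) ∈ P) :
    PartialIso (plain (glue ι₁ κ₁ G r H s)) (plain (glue ι₂ κ₂ G r H s))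
      {p | Matched e f A B P p} := by
  have heq : ∀ {x y x' y'}, (x, y) ∈ P → (x', y') ∈ P → (x = x' ↔ y = y') :=
    fun h h' => (hP _ h _ h').1
  have hadj : ∀ {x y x' y'}, (x, y) ∈ P → (x', y') ∈ P → (G.Adj x x' ↔ H.Adj y y') :=
    fun h h' => (hP _ h _ h').2.1
  have hroot : ∀ {x y}, (x, y) ∈ P → (x = r ↔ y = s) := fun h => heq h hr
  have hsome : ∀ {i a i' a'}, e i = some a → e i' = some a' → (i = i' ↔ a = a') := by
    intro i a i' a' h h'
    rw [← e.injective.eq_iff, h, h', Option.some_inj]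
  have hsome' : ∀ {i a i' a'}, f i = some a → f i' = some a' → (a = a' ↔ i = i') := by
    intro i a i' a' h h'
    rw [← f.injective.eq_iff, h, h', Option.some_inj]
  have hnone : ∀ {i i'}, e i = none → e i' = none → i = i' := fun h h' =>
    e.injective (h.trans h'.symm)
  have hnone' : ∀ {i i'}, f i = none → f i' = none → i = i' := fun h h' =>
    f.injective (h.trans h'.symm)
  rintro p (_ | ⟨x, hi, h⟩ | ⟨y, hj, h⟩ | ⟨hi, hj, h⟩) q
    (_ | ⟨x', hi', h'⟩ | ⟨y', hj', h'⟩ | ⟨hi', hj', h'⟩)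
  all_goals refine ⟨?_, ?_, fun c => c.elim0⟩
  all_goals simp [plain]
  all_goals grind

lemma BackForth.matched_of_unmatched (q : ℕ) : ∀ {P : Set (V × W)},
    BackForth (PartialIso (plain G) (plain H)) q P → (r, s) ∈ P →
      BackForth (PartialIso (plain (glue ι₁ κ₁ G r H s)) (plain (glue ι₂ κ₂ G r H s))) q
        {p | Matched e f Set.univ Set.univ P p} := by
  have hmono : Antitone (PartialIso (plain (glue ι₁ κ₁ G r H s)) (plain (glue ι₂ κ₂ G r H s))) :=
    PartialIso.mono
  have hmono' : Antitone (PartialIso (plain G) (plain H)) := PartialIso.mono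
  have : Nonempty V := ⟨r⟩
  induction q with
  | zero => exact fun h hr => PartialIso.matched h hr
  | succ q ih =>
    intro P h hr
    have hstep : ∀ p, Matched e f Set.univ Set.univ P p → BackForth (PartialIso
        (plain (glue ι₁ κ₁ G r H s)) (plain (glue ι₂ κ₂ G r H s))) q
        (insert p {p | Matched e f Set.univ Set.univ P p}) := fun p hp => by
      rw [Set.insert_eq_of_mem (show p ∈ {p | _} from hp)]
      exact ih (h.of_succ hmono') hr
    have hstep' : ∀ x y i j, e i = none → f j = none →
        BackForth (PartialIso (plain G) (plain H)) q (insert (x, y) P) →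
        BackForth (PartialIso (plain (glue ι₁ κ₁ G r H s)) (plain (glue ι₂ κ₂ G r H s))) q
        (insert (some (.inl (i, x)), some (.inr (j, y)))
          {p | Matched e f Set.univ Set.univ P p}) := fun x y i j hi hj hxy => by
      refine (ih hxy (Set.mem_insert_of_mem _ hr)).mono hmono q (Set.insert_subset ?_ ?_)
      · exact .unmatched hi hj (Set.mem_insert _ _)
      · exact fun p hp => hp.mono_right (Set.subset_insert _ _)
    constructor
    · rintro (_ | ⟨i, x⟩ | ⟨j, y⟩)
      · exact ⟨none, hstep _ .root⟩
      · rcases hi : e i with _ | i'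
        · obtain ⟨y, hy⟩ := h.1 x
          exact ⟨_, hstep' x y i (f.symm none) hi (by simp) hy⟩
        · exact ⟨_, hstep _ (.inl x (Set.mem_univ i) hi)⟩
      · exact ⟨_, hstep _ (.inr y (Set.mem_univ (f.symm (some j))) (by simp))⟩
    · rintro (_ | ⟨i, x⟩ | ⟨j, y⟩)
      · exact ⟨none, hstep _ .root⟩
      · exact ⟨_, hstep _ (.inl x (Set.mem_univ (e.symm (some i))) (by simp))⟩
      · rcases hj : f j with _ | j'
        · obtain ⟨x, hx⟩ := h.2 y
          exact ⟨_, hstep' x y (e.symm none) j (by simp) hj hx⟩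
        · exact ⟨_, hstep _ (.inr y (Set.mem_univ j) hj)⟩

/-- A matching can be modified outside a small set in order to match a given element. -/
lemma exists_matching {ι ι' : Type} [Fintype ι] [DecidableEq ι] (e : ι ≃ Option ι') {A : Finset ι}
    (hA : A.card + 1 < Fintype.card ι) (he : ∀ i ∈ A, e i ≠ none) (i : ι) :
    ∃ e' : ι ≃ Option ι', (∀ a ∈ A, e a = e' a) ∧ e' i ≠ none := by
  by_cases hi : e i = none
  · obtain ⟨i₁, hi₁⟩ : ∃ i₁, i₁ ∉ insert i A := by
      by_contra! h
      have := Finset.card_insert_le i A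
      rw [Finset.eq_univ_iff_forall.2 h, Finset.card_univ] at this
      omega
    rw [Finset.mem_insert, not_or] at hi₁
    refine ⟨(Equiv.swap i i₁).trans e, fun a ha => ?_, ?_⟩
    · rw [Equiv.trans_apply, Equiv.swap_apply_of_ne_of_ne]
      · rintro rfl
        exact he _ ha hi
      · rintro rfl
        exact hi₁.2 ha
    · rw [Equiv.trans_apply, Equiv.swap_apply_left]
      exact fun h => hi₁.1 (e.injective (h.trans hi.symm))
  · exact ⟨e, fun _ _ => rfl, hi⟩

/-- As long as fewer copies have been touched than are available, Duplicator can postpone the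
decision which copies remain unmatched. -/
lemma BackForth.matched [Fintype ι₁] [Fintype κ₂] {q : ℕ}
    (h : BackForth (PartialIso (plain G) (plain H)) q {(r, s)}) (t : ℕ) :
    ∀ (e : ι₁ ≃ Option ι₂) (f : κ₂ ≃ Option κ₁) (A : Finset ι₁) (B : Finset κ₂),
      A.card + t < Fintype.card ι₁ → B.card + t < Fintype.card κ₂ →
      (∀ i ∈ A, e i ≠ none) → (∀ j ∈ B, f j ≠ none) →
      BackForth (PartialIso (plain (glue ι₁ κ₁ G r H s)) (plain (glue ι₂ κ₂ G r H s))) (q + t)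
        {p | Matched e f A B (∅ : Set (V × W)) p} := by
  classical
  have hmono : Antitone (PartialIso (plain (glue ι₁ κ₁ G r H s)) (plain (glue ι₂ κ₂ G r H s))) :=
    PartialIso.mono
  induction t with
  | zero =>
    intro e f A B _ _ _ _
    exact (h.matched_of_unmatched q rfl).mono hmono q fun p hp =>
      hp.mono (Set.subset_univ _) (Set.subset_univ _) (fun _ _ => rfl) (fun _ _ => rfl)
  | succ t ih =>
    intro e f A B hA hB he hf
    have hroot : BackForth (PartialIso (plain (glue ι₁ κ₁ G r H s)) (plain (glue ι₂ κ₂ G r H s)))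
        (q + t) (insert (none, none) {p | Matched e f A B (∅ : Set (V × W)) p}) := by
      rw [Set.insert_eq_of_mem (show _ ∈ {p | _} from Matched.root)]
      exact ih e f A B (by omega) (by omega) he hf
    have hinl : ∀ (e' : ι₁ ≃ Option ι₂) i i' x, (∀ a ∈ A, e a = e' a) → e' i = some i' →
        BackForth (PartialIso (plain (glue ι₁ κ₁ G r H s)) (plain (glue ι₂ κ₂ G r H s)))
        (q + t) (insert (some (.inl (i, x)), some (.inl (i', x)))
          {p | Matched e f A B (∅ : Set (V × W)) p}) := by
      intro e' i i' x hee hi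
      refine (ih e' f (insert i A) B (by have := Finset.card_insert_le i A; omega) (by omega)
        ?_ hf).mono hmono _ (Set.insert_subset (.inl x (by simp) hi) fun p hp =>
          hp.mono (by simp) subset_rfl hee fun _ _ => rfl)
      intro a ha
      rcases Finset.mem_insert.1 ha with rfl | ha
      · simp [hi]
      · exact hee a ha ▸ he a ha
    have hinr : ∀ (f' : κ₂ ≃ Option κ₁) j j' y, (∀ a ∈ B, f a = f' a) → f' j = some j' →
        BackForth (PartialIso (plain (glue ι₁ κ₁ G r H s)) (plain (glue ι₂ κ₂ G r H s)))
        (q + t) (insert (some (.inr (j', y)), some (.inr (j, y)))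
          {p | Matched e f A B (∅ : Set (V × W)) p}) := by
      intro f' j j' y hff hj
      refine (ih e f' A (insert j B) (by omega) (by have := Finset.card_insert_le j B; omega)
        he ?_).mono hmono _ (Set.insert_subset (.inr y (by simp) hj) fun p hp =>
          hp.mono subset_rfl (by simp) (fun _ _ => rfl) hff)
      intro a ha
      rcases Finset.mem_insert.1 ha with rfl | ha
      · simp [hj]
      · exact hff a ha ▸ hf a ha
    constructor
    · rintro (_ | ⟨i, x⟩ | ⟨j, y⟩)
      · exact ⟨none, hroot⟩
      · obtain ⟨e', he', hi⟩ := exists_matching e (by omega) he i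
        obtain ⟨i', hi'⟩ := Option.ne_none_iff_exists'.1 hi
        exact ⟨_, hinl e' i i' x he' hi'⟩
      · exact ⟨_, hinr f (f.symm (some j)) j y (fun _ _ => rfl) (by simp)⟩
    · rintro (_ | ⟨i, x⟩ | ⟨j, y⟩)
      · exact ⟨none, hroot⟩
      · exact ⟨_, hinl e (e.symm (some i)) i x (fun _ _ => rfl) (by simp)⟩
      · obtain ⟨f', hf', hj⟩ := exists_matching f (by omega) hf j
        obtain ⟨j', hj'⟩ := Option.ne_none_iff_exists'.1 hj
        exact ⟨_, hinr f' j j' y hf' hj'⟩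

end game

/-- A tree whose vertices are graded by their distance from the root `r`, where the root has degree
at most `c` and every vertex has degree at most `c + 1`. -/
structure IsRootedTree (G : SimpleGraph V) (r : V) (c : ℕ) : Prop where
  connected : G.Connected
  exists_height : ∃ h : V → ℕ, h r = 0 ∧ (∀ v w, G.Adj v w → h v ≠ h w) ∧
    ∀ v a b, G.Adj v a → G.Adj v b → h a ≤ h v → h b ≤ h v → a = b
  deg_root : deg G r ≤ c
  deg_le : ∀ v, deg G v ≤ c + 1

lemma IsRootedTree.isAcyclic {G : SimpleGraph V} {r : V} {c : ℕ} (hG : IsRootedTree G r c) :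
    G.IsAcyclic := by
  classical
  obtain ⟨h, -, -, hh⟩ := hG.exists_height
  intro v p hp
  obtain ⟨u, hu, hmax⟩ := p.support.toFinset.exists_max_image h ⟨v, by simp⟩
  rw [List.mem_toFinset] at hu
  have hq := hp.rotate hu
  have hle : ∀ w ∈ (p.rotate u hu).support, h w ≤ h u := fun w hw =>
    hmax w (by simpa using hw)
  refine hq.snd_ne_penultimate (hh u _ _ ((p.rotate u hu).adj_snd hq.not_nil)
    ((p.rotate u hu).adj_penultimate hq.not_nil).symm (hle _ ?_) (hle _ ?_))
  · exact (p.rotate u hu).getVert_mem_support _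
  · exact (p.rotate u hu).getVert_mem_support _

lemma deg_le_of_subset_image {V' : Type} [Finite V'] {G : SimpleGraph V} {G' : SimpleGraph V'}
    {v : V} {v' : V'} {g : V' → V} (h : ∀ w, G.Adj v w → ∃ x, G'.Adj v' x ∧ g x = w) :
    deg G v ≤ deg G' v' := by
  have : {w | G.Adj v w} ⊆ g '' {x | G'.Adj v' x} := fun w hw => h w hw
  exact (Set.ncard_le_ncard this (Set.toFinite _)).trans (Set.ncard_image_le (Set.toFinite _))

lemma deg_le_of_subset_insert_image {V' : Type} [Finite V'] {G : SimpleGraph V}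
    {G' : SimpleGraph V'} {v u : V} {v' : V'} {g : V' → V}
    (h : ∀ w, G.Adj v w → w = u ∨ ∃ x, G'.Adj v' x ∧ g x = w) : deg G v ≤ deg G' v' + 1 := by
  have : {w | G.Adj v w} ⊆ insert u (g '' {x | G'.Adj v' x}) := fun w hw => h w hw
  exact (Set.ncard_le_ncard this (Set.toFinite _)).trans ((Set.ncard_insert_le _ _).trans
    (Nat.add_le_add_right (Set.ncard_image_le (Set.toFinite _)) 1))

lemma isRootedTree_glue {ι κ : Type} [Fintype ι] [Fintype κ] [Finite V] [Finite W]
    {G : SimpleGraph V} {r : V} {H : SimpleGraph W} {s : W} {c : ℕ} (hG : IsRootedTree G r c)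
    (hH : IsRootedTree H s c) (hc : Fintype.card ι + Fintype.card κ ≤ c) :
    IsRootedTree (glue ι κ G r H s) none c := by
  have hnone : deg (glue ι κ G r H s) none ≤ c := by
    let g : ι ⊕ κ → Option ((ι × V) ⊕ (κ × W)) :=
      fun i => some (i.map (fun i => (i, r)) (fun j => (j, s)))
    have : {w | (glue ι κ G r H s).Adj none w} ⊆ g '' Set.univ := by
      rintro (_ | ⟨i, x⟩ | ⟨j, y⟩) h
      · exact absurd h (by simp)
      · exact ⟨.inl i, by simp_all [g]⟩
      · exact ⟨.inr j, by simp_all [g]⟩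
    refine (Set.ncard_le_ncard this (Set.toFinite _)).trans
      ((Set.ncard_image_le (Set.toFinite _)).trans ?_)
    simpa [Set.ncard_univ] using hc
  refine ⟨?_, ?_, hnone, ?_⟩
  · have hr : ∀ v, (glue ι κ G r H s).Reachable none v := by
      rintro (_ | ⟨i, x⟩ | ⟨j, y⟩)
      · exact .rfl
      · refine SimpleGraph.Reachable.trans (v := some (.inl (i, r)))
          (SimpleGraph.Adj.reachable (by simp)) ?_
        exact (hG.connected r x).map (⟨fun x => some (.inl (i, x)), fun h => by simpa using h⟩ :
          G →g glue ι κ G r H s)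
      · refine SimpleGraph.Reachable.trans (v := some (.inr (j, s)))
          (SimpleGraph.Adj.reachable (by simp)) ?_
        exact (hH.connected s y).map (⟨fun y => some (.inr (j, y)), fun h => by simpa using h⟩ :
          H →g glue ι κ G r H s)
    exact ⟨fun v w => (hr v).symm.trans (hr w)⟩
  · obtain ⟨g, hg₁, hg₂, hg₃⟩ := hG.exists_height
    obtain ⟨h, hh₁, hh₂, hh₃⟩ := hH.exists_height
    refine ⟨fun | none => 0 | some (.inl p) => g p.2 + 1 | some (.inr p) => h p.2 + 1, rfl, ?_, ?_⟩
    · rintro (_ | ⟨i, x⟩ | ⟨j, y⟩) (_ | ⟨i', x'⟩ | ⟨j', y'⟩) hadj <;> simp_all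
    · rintro (_ | ⟨i, x⟩ | ⟨j, y⟩) (_ | ⟨i', x'⟩ | ⟨j', y'⟩) (_ | ⟨i'', x''⟩ | ⟨j'', y''⟩) ha hb
      all_goals simp
      all_goals grind [glue_adj_inl_inl, glue_adj_inr_inr, glue_adj_inl_none, glue_adj_inr_none,
        glue_adj_inl_inr, glue_adj_inr_inl]
  · rintro (_ | ⟨i, x⟩ | ⟨j, y⟩)
    · omega
    · by_cases hx : x = r
      · subst hx
        refine (deg_le_of_subset_insert_image (G' := G) (v' := x) (u := none)
          (g := fun x => some (.inl (i, x))) ?_).trans (Nat.add_le_add_right hG.deg_root 1)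
        rintro (_ | ⟨i', x'⟩ | ⟨j', y'⟩) h <;> simp_all
      · refine (deg_le_of_subset_image (G' := G) (v' := x)
          (g := fun x => some (.inl (i, x))) ?_).trans (hG.deg_le x)
        rintro (_ | ⟨i', x'⟩ | ⟨j', y'⟩) h <;> simp_all
    · by_cases hy : y = s
      · subst hy
        refine (deg_le_of_subset_insert_image (G' := H) (v' := y) (u := none)
          (g := fun y => some (.inr (j, y))) ?_).trans (Nat.add_le_add_right hH.deg_root 1)
        rintro (_ | ⟨i', x'⟩ | ⟨j', y'⟩) h <;> simp_all
      · refine (deg_le_of_subset_image (G' := H) (v' := y)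
          (g := fun y => some (.inr (j, y))) ?_).trans (hH.deg_le y)
        rintro (_ | ⟨i', x'⟩ | ⟨j', y'⟩) h <;> simp_all

/-- Two trees of different sizes on which Duplicator survives `d * m` rounds. -/
theorem exists_pair (m d : ℕ) : ∃ (V W : Type) (_ : Fintype V) (_ : Fintype W)
    (G : SimpleGraph V) (H : SimpleGraph W) (r : V) (s : W), IsRootedTree G r (2 * m + 1) ∧
      IsRootedTree H s (2 * m + 1) ∧ Fintype.card W = Fintype.card V + 1 ∧
      Fintype.card W ≤ 2 * (2 * m + 2) ^ d ∧
      BackForth (PartialIso (plain G) (plain H)) (d * m) {(r, s)} := by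
  induction d with
  | zero =>
    refine ⟨Unit, Bool, inferInstance, inferInstance, ⊥, ⊤, (), false, ⟨?_, ?_, ?_, ?_⟩,
      ⟨?_, ?_, ?_, ?_⟩, by simp, by simp, ?_⟩
    · exact SimpleGraph.Connected.of_subsingleton
    · exact ⟨fun _ => 0, by simp⟩
    · simp [deg]
    · simp [deg]
    · exact SimpleGraph.connected_top
    · exact ⟨fun b => b.toNat, by simp⟩
    · simp [deg]
    · simp [deg]
    · rw [Nat.zero_mul]
      rintro _ rfl _ rfl
      simp [plain]
  | succ d ih =>
    obtain ⟨V, W, _, _, G, H, r, s, hG, hH, h₁, h₂, h⟩ := ih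
    refine ⟨_, _, inferInstance, inferInstance, glue (Fin (m + 1)) (Fin m) G r H s,
      glue (Fin m) (Fin (m + 1)) G r H s, none, none,
      isRootedTree_glue hG hH (by simp; omega), isRootedTree_glue hG hH (by simp; omega), ?_, ?_,
      ?_⟩
    · simp [h₁]
      ring
    · simp only [Fintype.card_option, Fintype.card_sum, Fintype.card_prod, Fintype.card_fin]
      calc _ ≤ (2 * m + 2) * Fintype.card W := by rw [h₁]; nlinarith
        _ ≤ (2 * m + 2) * (2 * (2 * m + 2) ^ d) := Nat.mul_le_mul_left _ h₂
        _ = _ := by ring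
    · rw [Nat.succ_mul]
      refine (h.matched m (finSuccEquiv m) (finSuccEquiv m) ∅ ∅ (by simp) (by simp)
        (by simp) (by simp)).mono PartialIso.mono _ ?_
      rintro _ rfl
      exact .root

/-- There are trees of maximum degree at most `2 * m + 2` and size at most `2 * (2 * m + 2) ^ d`
that need quantifier depth more than `d * m`. -/
theorem exists_lt_depth (m d : ℕ) : ∃ (N : ℕ) (T : SimpleGraph (Fin N)),
    N ≤ 2 * (2 * m + 2) ^ d ∧ T.Connected ∧ T.IsAcyclic ∧ (∀ v, deg T v ≤ 2 * m + 2) ∧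
      ∀ φ, CDefines (plain T) φ → d * m < φ.depth := by
  obtain ⟨V, W, _, _, G, H, r, s, hG, hH, h₁, h₂, h⟩ := exists_pair m d
  have e := Fintype.equivFin V
  have : Nonempty V := ⟨r⟩
  have : Nonempty W := ⟨s⟩
  have hiso : G ≃g G.comap e.symm := ⟨e, by simp⟩
  have hciso : CIso (plain G) (plain (G.comap e.symm)) := ⟨e, by simp [plain], fun c => c.elim0⟩
  refine ⟨_, G.comap e.symm, by omega, hiso.connected_iff.1 hG.connected,
    hiso.isAcyclic_iff.1 hG.isAcyclic, hciso.deg_le hG.deg_le, fun φ hφ => ?_⟩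
  refine lt_depth_of_cdefines hciso (h.mono PartialIso.mono _ (Set.empty_subset _)) (fun hVW => ?_)
    hφ
  have := hVW.card_eq
  simp only [Nat.card_eq_fintype_card] at this
  omega

open Filter Topology

lemma tendsto_log_div_self : Tendsto (fun l : ℕ => Real.log l / l) atTop (𝓝 0) :=
  (Real.isLittleO_log_id_atTop.comp_tendsto tendsto_natCast_atTop_atTop).tendsto_div_nhds_zero

lemma eventually_le_mul_log {ε : ℝ} (hε : 0 < ε) : ∀ᶠ l : ℕ in atTop, ∀ m : ℕ, 2 * m ≤ l + 1 →
    1 + (m : ℝ) ≤ (1 / 2 + ε) * (l / Real.log l) * Real.log (max 2 ((m : ℝ) - 1)) := by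
  have hlog2 : 0 < Real.log 2 := Real.log_pos one_lt_two
  let M : ℝ := max 3 (2 / ε)
  have hM : 3 ≤ M := le_max_left _ _
  have hM' : 2 ≤ ε * M := by
    rw [mul_comm, ← div_le_iff₀ hε]
    exact le_max_right _ _
  have hlog : Tendsto (fun l : ℕ => Real.log l) atTop atTop :=
    Real.tendsto_log_atTop.comp tendsto_natCast_atTop_atTop
  filter_upwards [eventually_ge_atTop 2,
    hlog.eventually_ge_atTop ((1 + 2 * ε) * Real.log 2 / ε),
    tendsto_log_div_self.eventually_le_const
      (show 0 < (1 / 2 + ε) * Real.log 2 / (M + 2) by positivity)] with l hl h₁ h₂ m hm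
  have hl' : (2 : ℝ) ≤ l := by exact_mod_cast hl
  have hl0 : 0 < Real.log l := Real.log_pos (by linarith)
  have hm' : 2 * (m : ℝ) ≤ l + 1 := by exact_mod_cast hm
  rw [div_le_iff₀ hε] at h₁
  rw [div_le_div_iff₀ (by linarith) (by linarith)] at h₂
  rw [mul_div_assoc', div_mul_eq_mul_div, le_div_iff₀ hl0]
  rcases le_or_gt ((m : ℝ) - 1) M with h | h
  · have h₃ : Real.log 2 ≤ Real.log (max 2 ((m : ℝ) - 1)) :=
      Real.log_le_log two_pos (le_max_left _ _)
    calc (1 + (m : ℝ)) * Real.log l ≤ (M + 2) * Real.log l :=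
          mul_le_mul_of_nonneg_right (by linarith) hl0.le
      _ ≤ (1 / 2 + ε) * l * Real.log 2 := by linarith
      _ ≤ _ := by gcongr
  · set x := (m : ℝ) - 1 with hx
    have he : Real.exp 1 ≤ x := by linarith [Real.exp_one_lt_three]
    have h₃ := Real.log_div_self_antitoneOn (show Real.exp 1 ≤ x from he)
      (show Real.exp 1 ≤ (l : ℝ) / 2 by linarith) (show x ≤ (l : ℝ) / 2 by linarith)
    beta_reduce at h₃
    rw [Real.log_div (by linarith) two_ne_zero, div_le_div_iff₀ (by linarith) (by linarith)] at h₃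
    rw [max_eq_right (by linarith)]
    have h₄ : 2 ≤ ε * x := hM'.trans (by gcongr)
    calc (1 + (m : ℝ)) * Real.log l ≤ ((1 + ε) * x) * Real.log l := by gcongr; linarith
      _ = ((1 + ε) * Real.log l) * x := by ring
      _ ≤ ((1 + 2 * ε) * (Real.log l - Real.log 2)) * x :=
          mul_le_mul_of_nonneg_right (by linarith) (by linarith)
      _ = (1 + 2 * ε) * ((Real.log l - Real.log 2) * x) := by ring
      _ ≤ (1 + 2 * ε) * (Real.log x * (l / 2)) := by gcongr
      _ = _ := by ring

lemma exists_cdefines_le_of_isColTree {l n m : ℕ} {A : ℝ}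
    (hA : ∀ m : ℕ, 2 * m ≤ l + 1 → 1 + (m : ℝ) ≤ A * Real.log (max 2 ((m : ℝ) - 1)))
    (C : CGraph K (Fin m)) (hC : IsColTree C) (hdeg : ∀ v, deg C.graph v ≤ l) (hm : m ≤ n) :
    ∃ φ : CForm K 0, φ.depth ≤ ⌈l + 10 + A * Real.log n⌉₊ + (Nat.log 2 n + 1 + 2) ∧
      CDefines C φ := by
  have hA0 : 0 ≤ A := by
    have h := hA 0 (by omega)
    norm_num at h
    exact (pos_of_mul_pos_left (by linarith) (Real.log_nonneg (by norm_num : (1 : ℝ) ≤ 2))).le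
  have hm0 : 0 < m := Fin.pos_iff_nonempty.2 hC.1.nonempty
  refine exists_cdefines_of_isColTree hA C hC hdeg (le_trans ?_ (Nat.le_ceil _))
    (hm.trans (Nat.lt_pow_succ_log_self one_lt_two n).le)
  gcongr

lemma dcol_le_of_cdefines {C : CGraph K V} {φ : CForm K 0} (h : CDefines C φ) :
    Dcol C ≤ φ.depth :=
  Nat.sInf_le ⟨φ, rfl, h⟩

lemma exists_depth_eq_dcol {C : CGraph K V} {φ : CForm K 0} (h : CDefines C φ) :
    ∃ ψ : CForm K 0, ψ.depth = Dcol C ∧ CDefines C ψ :=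
  Nat.sInf_mem (s := {d | ∃ φ : CForm K 0, φ.depth = d ∧ CDefines C φ}) ⟨_, φ, rfl, h⟩

lemma mem_upperBounds_dtree {l n : ℕ} {A : ℝ}
    (hA : ∀ m : ℕ, 2 * m ≤ l + 1 → 1 + (m : ℝ) ≤ A * Real.log (max 2 ((m : ℝ) - 1))) :
    ⌈l + 10 + A * Real.log n⌉₊ + (Nat.log 2 n + 1 + 2) ∈ upperBounds
      {d | ∃ (K m : ℕ) (C : CGraph K (Fin m)), IsColTree C ∧ m ≤ n ∧
        (∀ v, deg C.graph v ≤ l) ∧ d = Dcol C} := by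
  rintro _ ⟨K, m, C, hC, hm, hdeg, rfl⟩
  obtain ⟨φ, hφ, h⟩ := exists_cdefines_le_of_isColTree hA C hC hdeg hm
  exact (dcol_le_of_cdefines h).trans hφ

/-- The upper bound on the logical depth of trees. -/
theorem dtree_le {l n : ℕ} {A : ℝ} (hA0 : 0 ≤ A)
    (hA : ∀ m : ℕ, 2 * m ≤ l + 1 → 1 + (m : ℝ) ≤ A * Real.log (max 2 ((m : ℝ) - 1))) :
    (Dtree n l : ℝ) ≤ l + 14 + A * Real.log n + Real.log n / Real.log 2 := by
  have hlog : 0 ≤ Real.log n := Real.log_natCast_nonneg n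
  have h₁ : (Dtree n l : ℝ) ≤ (⌈l + 10 + A * Real.log n⌉₊ + (Nat.log 2 n + 1 + 2) : ℕ) :=
    Nat.cast_le.2 (csSup_le' (mem_upperBounds_dtree hA))
  have h₂ := Nat.ceil_lt_add_one (show 0 ≤ l + 10 + A * Real.log n by positivity)
  have h₃ := Real.natLog_le_logb n 2
  rw [← Real.log_div_log] at h₃
  push_cast at h₁ h₃
  linarith

lemma dcol_le_dtree {l n m : ℕ} {A : ℝ}
    (hA : ∀ m : ℕ, 2 * m ≤ l + 1 → 1 + (m : ℝ) ≤ A * Real.log (max 2 ((m : ℝ) - 1)))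
    {C : CGraph K (Fin m)} (hC : IsColTree C) (hdeg : ∀ v, deg C.graph v ≤ l) (hm : m ≤ n) :
    Dcol C ≤ Dtree n l :=
  le_csSup ⟨_, mem_upperBounds_dtree hA⟩ ⟨K, m, C, hC, hm, hdeg, rfl⟩

/-- The lower bound on the logical depth of trees. -/
theorem exists_le_dcol {l n : ℕ} {A : ℝ} (hl : 3 ≤ l) (hn : l ≤ n)
    (hA : ∀ m : ℕ, 2 * m ≤ l + 1 → 1 + (m : ℝ) ≤ A * Real.log (max 2 ((m : ℝ) - 1))) :
    ∃ (m : ℕ) (T : SimpleGraph (Fin m)), m ≤ n ∧ T.Connected ∧ T.IsAcyclic ∧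
      (∀ v, deg T v ≤ l) ∧
      (Real.log n / Real.log l - 2) * (((l : ℝ) - 3) / 2) ≤ (Dcol (plain T) : ℝ) := by
  obtain ⟨d, hd⟩ := Nat.exists_eq_add_of_le' (Nat.log_pos (by omega : 1 < l) hn)
  obtain ⟨N, T, hN, hT, hT', hdeg, hdepth⟩ := exists_lt_depth ((l - 2) / 2) d
  have hdeg' : ∀ v, deg T v ≤ l := fun v => (hdeg v).trans (by omega)
  have hNn : N ≤ n := by
    refine hN.trans (le_trans ?_ (Nat.pow_log_le_self l (by omega : n ≠ 0)))
    rw [hd, Nat.pow_succ']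
    exact Nat.mul_le_mul (by omega) (Nat.pow_le_pow_left (by omega) _)
  refine ⟨N, T, hNn, hT, hT', hdeg', ?_⟩
  obtain ⟨φ, -, hφ⟩ := exists_cdefines_le_of_isColTree hA (plain T) ⟨hT, hT'⟩ hdeg' hNn
  obtain ⟨ψ, hψ, hψ'⟩ := exists_depth_eq_dcol hφ
  have h₁ : ((d * ((l - 2) / 2) : ℕ) : ℝ) ≤ Dcol (plain T) :=
    Nat.cast_le.2 (hψ ▸ (hdepth ψ hψ').le)
  refine le_trans ?_ h₁
  have hl' : (3 : ℝ) ≤ l := by exact_mod_cast hl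
  have hR : Real.log n / Real.log l - 2 ≤ d := by
    have h := Nat.lt_pow_succ_log_self (by omega : 1 < l) n
    have h' := Real.log_le_log (by exact_mod_cast (by omega : 0 < n)) (Nat.cast_le (α := ℝ).2 h.le)
    rw [hd, Nat.cast_pow, Real.log_pow, ← div_le_iff₀ (Real.log_pos (by linarith))] at h'
    push_cast at h'
    linarith
  have hm : ((l : ℝ) - 3) / 2 ≤ ((l - 2) / 2 : ℕ) := by
    have : (l : ℝ) ≤ 2 * ((l - 2) / 2 : ℕ) + 3 := by
      exact_mod_cast (by omega : l ≤ 2 * ((l - 2) / 2) + 3)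
    linarith
  rw [Nat.cast_mul]
  exact mul_le_mul hR hm (by linarith) (Nat.cast_nonneg _)

end FODef

open Filter FODef

theorem statement0 (l : ℕ → ℕ) (hpos : ∀ n, 1 ≤ l n)
    (hl : Tendsto l atTop atTop)
    (hratio : Tendsto (fun n : ℕ => Real.log n / Real.log (l n)) atTop atTop) :
    Tendsto (fun n : ℕ => (Dtree n (l n) : ℝ) * Real.log (l n) / ((l n : ℝ) * Real.log n))
      atTop (nhds (1 / 2)) ∧
    ∀ ε : ℝ, 0 < ε → ∀ᶠ n in atTop, ∃ (m : ℕ) (T : SimpleGraph (Fin m)),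
      m ≤ n ∧ T.Connected ∧ T.IsAcyclic ∧ (∀ v, deg T v ≤ l n) ∧
      (1 / 2 - ε) * ((l n : ℝ) * Real.log n / Real.log (l n)) ≤ (Dcol (plain T) : ℝ) := by
  have hlog : Tendsto (fun n : ℕ => Real.log n) atTop atTop :=
    Real.tendsto_log_atTop.comp tendsto_natCast_atTop_atTop
  have hl' : Tendsto (fun n => (l n : ℝ)) atTop atTop := tendsto_natCast_atTop_atTop.comp hl
  have hinv := hratio.inv_tendsto_atTop
  have hdiv : Tendsto (fun n => Real.log (l n) / l n) atTop (nhds 0) :=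
    tendsto_log_div_self.comp hl
  have hle : ∀ᶠ n in atTop, l n ≤ n := by
    filter_upwards [hratio.eventually_ge_atTop 1, hl.eventually_ge_atTop 2,
      eventually_ge_atTop 1] with n h₁ h₂ h₃
    have h₂' : (1 : ℝ) < l n := by exact_mod_cast h₂
    rw [le_div_iff₀ (Real.log_pos h₂'), one_mul,
      Real.log_le_log_iff (by linarith) (by exact_mod_cast h₃)] at h₁
    exact_mod_cast h₁
  have hlower : ∀ ε : ℝ, 0 < ε → ∀ᶠ n in atTop, ∃ (m : ℕ) (T : SimpleGraph (Fin m)),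
      m ≤ n ∧ T.Connected ∧ T.IsAcyclic ∧ (∀ v, deg T v ≤ l n) ∧
      (1 / 2 - ε) * ((l n : ℝ) * Real.log n / Real.log (l n)) ≤ (Dcol (plain T) : ℝ) := by
    intro ε hε
    have hlim : Tendsto (fun n : ℕ => (1 - 2 * (Real.log n / Real.log (l n))⁻¹) *
        ((1 - 3 * (l n : ℝ)⁻¹) / 2)) atTop (nhds ((1 - 2 * 0) * ((1 - 3 * 0) / 2))) :=
      ((hinv.const_mul 2).const_sub 1).mul
        (((hl'.inv_tendsto_atTop.const_mul 3).const_sub 1).div_const 2)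
    filter_upwards [hle, hl.eventually_ge_atTop 3, hl.eventually (eventually_le_mul_log one_pos),
      hlim.eventually_const_le (show 1 / 2 - ε < _ by linarith),
      hratio.eventually_gt_atTop 0] with n h₁ h₂ h₃ h₄ h₅
    obtain ⟨m, T, hm, hT, hT', hdeg, hD⟩ := exists_le_dcol h₂ h₁ h₃
    refine ⟨m, T, hm, hT, hT', hdeg, le_trans ?_ hD⟩
    have h₆ : (0 : ℝ) < l n := by exact_mod_cast hpos n
    rw [mul_div_assoc]
    refine (mul_le_mul_of_nonneg_right h₄ (by positivity)).trans (le_of_eq ?_)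
    generalize Real.log n / Real.log (l n) = R at *
    field_simp
  refine ⟨tendsto_order.2 ⟨fun a ha => ?_, fun a ha => ?_⟩, hlower⟩
  · filter_upwards [hlower ((1 / 2 - a) / 2) (by linarith),
      hl.eventually (eventually_le_mul_log one_pos), hratio.eventually_gt_atTop 0]
      with n ⟨m, T, hm, hT, hT', hdeg, hD⟩ h₁ h₂
    have h₃ := hD.trans (Nat.cast_le.2 (dcol_le_dtree h₁ (C := plain T) ⟨hT, hT'⟩ hdeg hm))
    have h₄ : (0 : ℝ) < l n := by exact_mod_cast hpos n
    have h₅ : 0 < (l n : ℝ) * Real.log n / Real.log (l n) := by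
      rw [mul_div_assoc]
      positivity
    rw [← div_div_eq_mul_div, lt_div_iff₀ h₅]
    exact (mul_lt_mul_of_pos_right (by linarith) h₅).trans_le h₃
  · have hε : 0 < (a - 1 / 2) / 2 := by linarith
    have hlim : Tendsto (fun n : ℕ => (Real.log n / Real.log (l n))⁻¹ +
        14 * (Real.log (l n) / l n) * (Real.log n)⁻¹ + (1 / 2 + (a - 1 / 2) / 2) +
        Real.log (l n) / l n / Real.log 2) atTop
        (nhds (0 + 14 * 0 * 0 + (1 / 2 + (a - 1 / 2) / 2) + 0 / Real.log 2)) :=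
      (((hinv.add ((hdiv.const_mul 14).mul hlog.inv_tendsto_atTop)).add_const _).add
        (hdiv.div_const _))
    filter_upwards [hl.eventually (eventually_le_mul_log hε), hl.eventually_ge_atTop 2,
      hlog.eventually_gt_atTop 0,
      hlim.eventually_lt_const (show _ < a by ring_nf; linarith)] with n h₁ h₂ h₃ h₅
    have h₂' : (1 : ℝ) < l n := by exact_mod_cast h₂
    have h₆ := Real.log_pos h₂'
    have h₇ := dtree_le (n := n) (by positivity) h₁
    refine lt_of_le_of_lt ?_ h₅
    rw [div_le_iff₀ (by positivity)]
    refine (mul_le_mul_of_nonneg_right h₇ h₆.le).trans (le_of_eq ?_)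
    field_simp
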